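/- Consider the Ising model on Λ_{M,N} = {1,…,2M}×{1,…,2N} at the critical inverse temperature β_c = ln(1+√2)/2, with Hamiltonian E_{M,N}(σ) = −∑_{j=1}^{2M}∑_{k=1}^{2N} σ_{j,k}σ_{j,k+1} − ∑_{j=1}^{2M−1}∑_{k=1}^{2N} σ_{j,k}σ_{j+1,k} (with σ_{j,2N+1} := σ_{j,1}) and Gibbs measure P_{M,N}(σ) = e^{−β_c E_{M,N}(σ)}/Z_{M,N}(β_c). Suppose M = M(N) is a positive-integer-valued function of N satisfying lim_{N→∞} N(ln ln N)²/(M(N)·ln N) = 0, and define the normalized energy Ê_{M,N} = (E_{M,N} + 4√2·M(N)·N − (4/π)·N·ln N)/√(4M(N)·N·ln N). Then for every fixed t ≥ 0, the Gibbs expectation ⟨e^{t·Ê_{M,N}}⟩ converges to e^{4t²/π} as N → ∞. -/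

import Mathlib

open Filter Finset

/-- The critical inverse temperature of the two-dimensional Ising model. -/
noncomputable def betac : ℝ := Real.log (1 + Real.sqrt 2) / 2

/-- The spin value (`±1`) associated to a Boolean. -/
noncomputable def spin (b : Bool) : ℝ := if b then 1 else -1

/-- The Hamiltonian (total energy) of the Ising model on `{1,…,2M} × {1,…,2N}` with
periodic boundary condition in the second (horizontal) direction and free boundary
condition in the first (vertical) direction:
`E_{M,N}(σ) = −∑_{j=1}^{2M}∑_{k=1}^{2N} σ_{j,k}σ_{j,k+1} − ∑_{j=1}^{2M−1}∑_{k=1}^{2N} σ_{j,k}σ_{j+1,k}`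
with `σ_{j,2N+1} := σ_{j,1}`. -/
noncomputable def energy (M N : ℕ) (σ : Fin (2 * M) × Fin (2 * N) → Bool) : ℝ :=
  - (∑ j : Fin (2 * M), ∑ k : Fin (2 * N),
      spin (σ (j, k)) * spin (σ (j, ⟨((k : ℕ) + 1) % (2 * N), Nat.mod_lt _ k.pos⟩)))
  - (∑ j : Fin (2 * M), ∑ k : Fin (2 * N),
      if h : (j : ℕ) + 1 < 2 * M then
        spin (σ (j, k)) * spin (σ (⟨(j : ℕ) + 1, h⟩, k)) else 0)

/-- The partition function `Z_{M,N}(β) = ∑_{σ ∈ {−1,+1}^{Λ_{M,N}}} e^{−β E_{M,N}(σ)}`. -/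
noncomputable def Zpart (M N : ℕ) (β : ℝ) : ℝ :=
  ∑ σ : Fin (2 * M) × Fin (2 * N) → Bool, Real.exp (-β * energy M N σ)

/-- The normalized total energy
`Ê_{M,N}(σ) = (E_{M,N}(σ) + 4√2·M·N − (4/π)·N·ln N)/√(4·M·N·ln N)`. -/
noncomputable def Ehat (M N : ℕ) (σ : Fin (2 * M) × Fin (2 * N) → Bool) : ℝ :=
  (energy M N σ + 4 * Real.sqrt 2 * M * N - (4 / Real.pi) * N * Real.log N) /
    Real.sqrt (4 * M * N * Real.log N)

namespace CI

/-- Rows of spins. -/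
abbrev Row (n : ℕ) := Fin n → Bool
/-- Complex functions on rows. -/
abbrev VS (n : ℕ) := Row n → ℂ

/-- complex spin value -/
noncomputable def csp (b : Bool) : ℂ := if b then 1 else -1

/-- flip the first `m` spins -/
def flipB {n : ℕ} (m : ℕ) (τ : Row n) : Row n := fun l => if (l : ℕ) < m then !(τ l) else τ l

lemma csp_not (b : Bool) : csp (!b) = - csp b := by cases b <;> simp [csp]
lemma csp_sq (b : Bool) : csp b * csp b = 1 := by cases b <;> simp [csp]

lemma flipB_flipB {n : ℕ} (m : ℕ) (τ : Row n) : flipB m (flipB m τ) = τ := by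
  funext l; simp only [flipB]; split_ifs <;> simp

lemma flipB_comm {n : ℕ} (m m' : ℕ) (τ : Row n) :
    flipB m (flipB m' τ) = flipB m' (flipB m τ) := by
  funext l; simp only [flipB]; split_ifs <;> simp

lemma flipB_zero {n : ℕ} (τ : Row n) : flipB 0 τ = τ := by
  funext l; simp [flipB]

lemma csp_flipB {n : ℕ} (m : ℕ) (τ : Row n) (l : Fin n) :
    csp (flipB m τ l) = (if (l : ℕ) < m then -1 else 1) * csp (τ l) := by
  simp only [flipB]; split_ifs <;> simp [csp_not]

/-- flipping as an equivalence -/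
def flipE {n : ℕ} (m : ℕ) : Row n ≃ Row n where
  toFun := flipB m
  invFun := flipB m
  left_inv := flipB_flipB m
  right_inv := flipB_flipB m

/-- Jordan-Wigner type operators -/
noncomputable def RR {n : ℕ} (k : Fin n) (m : ℕ) : Module.End ℂ (VS n) where
  toFun f := fun τ => csp (τ k) * f (flipB m τ)
  map_add' f g := by funext τ; simp [mul_add]
  map_smul' c f := by funext τ; simp; ring

lemma RR_apply {n : ℕ} (k : Fin n) (m : ℕ) (f : VS n) (τ : Row n) :
    RR k m f τ = csp (τ k) * f (flipB m τ) := rfl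

lemma RR_anti {n : ℕ} (k l : Fin n) (m m' : ℕ)
    (h : ((l : ℕ) < m ∧ ¬ (k : ℕ) < m') ∨ (¬ (l : ℕ) < m ∧ (k : ℕ) < m')) :
    RR k m * RR l m' + RR l m' * RR k m = 0 := by
  refine LinearMap.ext fun f => funext fun τ => ?_
  simp only [LinearMap.add_apply, Module.End.mul_apply, Pi.add_apply, RR_apply, csp_flipB,
    flipB_comm m m']
  rcases h with ⟨h1, h2⟩ | ⟨h1, h2⟩ <;> simp [h1, h2] <;> ring

lemma RR_sq {n : ℕ} (k : Fin n) (m : ℕ) :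
    RR k m * RR k m = (if (k : ℕ) < m then (-1 : ℂ) else 1) • (1 : Module.End ℂ (VS n)) := by
  refine LinearMap.ext fun f => funext fun τ => ?_
  simp only [Module.End.mul_apply, RR_apply, csp_flipB, flipB_flipB, LinearMap.smul_apply,
    Pi.smul_apply, Module.End.one_apply, smul_eq_mul]
  have := csp_sq (τ k)
  split_ifs <;> linear_combination (norm := ring_nf) (1 : ℂ) * f τ * this
  · linear_combination (-2) * f τ * this

/-- smeared operators -/
noncomputable def PP {n : ℕ} (x : Fin n → ℂ) : Module.End ℂ (VS n) := ∑ k, x k • RR k k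
/-- smeared operators -/
noncomputable def QQ {n : ℕ} (x : Fin n → ℂ) : Module.End ℂ (VS n) := ∑ k, x k • RR k (k + 1)

lemma smear {n : ℕ} {E : Type*} [Ring E] [Algebra ℂ E] (A B : Fin n → E) (c : ℂ)
    (h : ∀ k l, A k * B l + B l * A k = (if k = l then c else 0) • (1 : E)) (x y : Fin n → ℂ) :
    (∑ k, x k • A k) * (∑ l, y l • B l) + (∑ l, y l • B l) * (∑ k, x k • A k) =
      (c * ∑ k, x k * y k) • (1 : E) := by
  rw [Finset.sum_mul_sum, Finset.sum_mul_sum, Finset.sum_comm (s := Finset.univ)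
    (t := Finset.univ) (f := fun i j => y i • B i * x j • A j), ← Finset.sum_add_distrib]
  simp_rw [← Finset.sum_add_distrib]
  have : ∀ k l, x k • A k * y l • B l + y l • B l * x k • A k =
      (if k = l then c * (x k * y k) else 0) • (1 : E) := by
    intro k l
    rw [smul_mul_smul_comm, smul_mul_smul_comm, mul_comm (y l), ← smul_add, h, smul_smul]
    split_ifs with hkl
    · subst hkl; congr 1; ring
    · simp
  simp_rw [this, ← Finset.sum_smul]
  simp [Finset.mul_sum]

lemma PP_PP {n : ℕ} (x y : Fin n → ℂ) :
    PP x * PP y + PP y * PP x = (2 * ∑ k, x k * y k) • (1 : Module.End ℂ (VS n)) := by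
  refine smear _ _ 2 (fun k l => ?_) x y
  split_ifs with h
  · subst h; rw [RR_sq]; simp [two_smul]
  · rw [RR_anti]
    · simp
    · have : (k : ℕ) ≠ l := fun h' => h (Fin.ext h')
      omega

lemma QQ_QQ {n : ℕ} (x y : Fin n → ℂ) :
    QQ x * QQ y + QQ y * QQ x = (-2 * ∑ k, x k * y k) • (1 : Module.End ℂ (VS n)) := by
  refine smear _ _ (-2) (fun k l => ?_) x y
  split_ifs with h
  · subst h; rw [RR_sq, ← add_smul]; norm_num
  · rw [RR_anti]
    · simp
    · have : (k : ℕ) ≠ l := fun h' => h (Fin.ext h')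
      omega

lemma PP_QQ {n : ℕ} (x y : Fin n → ℂ) :
    PP x * QQ y + QQ y * PP x = (0 : Module.End ℂ (VS n)) := by
  have := smear (fun k : Fin n => RR k (k : ℕ)) (fun k : Fin n => RR k ((k : ℕ) + 1)) 0
    (fun k l => ?_) x y
  · simpa [PP, QQ] using this
  · rw [RR_anti]
    · simp
    · omega

/-- vacuum -/
noncomputable def Om (n : ℕ) : VS n := fun _ => 1

lemma PP_Om {n : ℕ} (x : Fin n → ℂ) : PP x (Om n) = QQ x (Om n) := by
  funext τ
  simp [PP, QQ, RR_apply, Om]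

/-- pairing with vacuum -/
noncomputable def ev {n : ℕ} : VS n →ₗ[ℂ] ℂ where
  toFun f := ∑ τ, f τ
  map_add' f g := by simp [Finset.sum_add_distrib]
  map_smul' c f := by simp [Finset.mul_sum]

lemma ev_RR {n : ℕ} (k : Fin n) (f : VS n) : ev (RR k k f) + ev (RR k (k + 1) f) = 0 := by
  have h1 : ev (RR k k f) = ∑ τ, csp (τ k) * f τ := by
    rw [← Equiv.sum_comp (flipE (k : ℕ))]
    refine Finset.sum_congr rfl fun τ _ => ?_
    simp [flipE, RR_apply, csp_flipB]
  have h2 : ev (RR k (k + 1) f) = - ∑ τ, csp (τ k) * f τ := by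
    rw [← Equiv.sum_comp (flipE ((k : ℕ) + 1)), ← Finset.sum_neg_distrib]
    refine Finset.sum_congr rfl fun τ _ => ?_
    simp [flipE, RR_apply, csp_flipB]
  rw [h1, h2]; ring

/-- creation operators -/
noncomputable def CC {n : ℕ} (x : Fin n → ℂ) : Module.End ℂ (VS n) := PP x + QQ x

lemma ev_CC {n : ℕ} (x : Fin n → ℂ) (f : VS n) : ev (CC x f) = 0 := by
  have : CC x f = ∑ k, x k • (RR k k f + RR k (k+1) f) := by
    simp [CC, PP, QQ, LinearMap.sum_apply, Finset.sum_add_distrib, smul_add]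
  rw [this, map_sum]
  refine Finset.sum_eq_zero fun k _ => ?_
  rw [map_smul, map_add, ev_RR, smul_zero]

/-- vertical transfer matrix -/
noncomputable def V2 {n : ℕ} (K : ℝ) : Module.End ℂ (VS n) where
  toFun f := fun τ => ∑ τ', (∏ k, Complex.exp (K * (csp (τ k) * csp (τ' k)))) * f τ'
  map_add' f g := by funext τ; simp [mul_add, Finset.sum_add_distrib]
  map_smul' c f := by
    funext τ; simp [Finset.mul_sum]
    exact Finset.sum_congr rfl fun _ _ => by ring

/-- weight -/
noncomputable def ww {n : ℕ} (K : ℝ) (τ τ' : Row n) : ℂ :=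
  ∏ k, Complex.exp (K * (csp (τ k) * csp (τ' k)))

lemma V2_apply {n : ℕ} (K : ℝ) (f : VS n) (τ : Row n) :
    V2 K f τ = ∑ τ', ww K τ τ' * f τ' := rfl

lemma ww_flip {n : ℕ} (K : ℝ) (m : ℕ) (τ τ' : Row n) :
    ww K (flipB m τ) τ' = ww K τ (flipB m τ') := by
  unfold ww
  refine Finset.prod_congr rfl fun k _ => ?_
  rw [csp_flipB, csp_flipB]; split_ifs <;> ring_nf

lemma ww_key {n : ℕ} (K : ℝ) (k : Fin n) (τ τ' : Row n) :
    csp (τ' k) * (ww K τ (flipB k τ') - ww K τ (flipB (k + 1) τ')) =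
    Complex.tanh K * csp (τ k) * (ww K τ (flipB k τ') + ww K τ (flipB (k + 1) τ')) := by
  unfold ww
  rw [← Finset.mul_prod_erase _ _ (Finset.mem_univ k),
    ← Finset.mul_prod_erase _ (fun l => Complex.exp (K * (csp (τ l) * csp (flipB (k + 1) τ' l))))
      (Finset.mem_univ k)]
  have h : ∏ l ∈ Finset.univ.erase k, Complex.exp (K * (csp (τ l) * csp (flipB (k + 1) τ' l))) =
     ∏ l ∈ Finset.univ.erase k, Complex.exp (K * (csp (τ l) * csp (flipB k τ' l))) := by
    refine Finset.prod_congr rfl fun l hl => ?_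
    have hlk : (l : ℕ) ≠ k := fun h => Finset.ne_of_mem_erase hl (Fin.ext h)
    have : ((l : ℕ) < k + 1) ↔ ((l : ℕ) < k) := by omega
    simp [csp_flipB, this]
  rw [h]
  generalize ∏ l ∈ Finset.univ.erase k, Complex.exp (K * (csp (τ l) * csp (flipB k τ' l))) = X
  simp only [csp_flipB, lt_irrefl, if_false, Nat.lt_succ_self, if_true]
  have hc : Complex.cosh (K : ℂ) ≠ 0 := by
    rw [← Complex.ofReal_cosh]; exact_mod_cast (Real.cosh_pos K).ne'
  have ht : Complex.tanh K * Complex.cosh K = Complex.sinh K := by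
    rw [Complex.tanh_eq_sinh_div_cosh]; field_simp
  have e1 : Complex.exp K = Complex.cosh K + Complex.sinh K := (Complex.cosh_add_sinh _).symm
  have e2 : Complex.exp (-K) = Complex.cosh K - Complex.sinh K := (Complex.cosh_sub_sinh _).symm
  generalize Complex.cosh (K : ℂ) = ch at *
  generalize Complex.sinh (K : ℂ) = sh at *
  generalize Complex.tanh (K : ℂ) = th at *
  cases τ k <;> cases τ' k <;> simp only [csp, Bool.false_eq_true, if_false, if_true, mul_one,
    one_mul, mul_neg, neg_mul, neg_neg, e1, e2] <;>
    first | (linear_combination 2 * X * ht) | (linear_combination (-2) * X * ht)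

lemma V2_RR {n : ℕ} (K : ℝ) (k : Fin n) (f : VS n) :
    V2 K (RR k k f) + V2 K (RR k (k+1) f) =
      Complex.tanh K • (RR k k (V2 K f) + RR k (k+1) (V2 K f)) := by
  funext τ
  simp only [Pi.add_apply, Pi.smul_apply, smul_eq_mul, V2_apply, RR_apply, ww_flip]
  have a1 : ∑ τ', ww K τ τ' * (csp (τ' k) * f (flipB k τ')) =
     ∑ τ', csp (τ' k) * ww K τ (flipB k τ') * f τ' := by
    rw [← Equiv.sum_comp (flipE (k : ℕ))]
    refine Finset.sum_congr rfl fun τ' _ => ?_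
    simp [flipE, csp_flipB, flipB_flipB]; ring
  have a2 : ∑ τ', ww K τ τ' * (csp (τ' k) * f (flipB (k + 1) τ')) =
     - ∑ τ', csp (τ' k) * ww K τ (flipB (k+1) τ') * f τ' := by
    rw [← Equiv.sum_comp (flipE ((k : ℕ) + 1)), ← Finset.sum_neg_distrib]
    refine Finset.sum_congr rfl fun τ' _ => ?_
    simp only [flipE, Equiv.coe_fn_mk, csp_flipB, flipB_flipB]; simp; ring
  rw [a1, a2, ← sub_eq_add_neg, ← Finset.sum_sub_distrib, ← mul_add, ← Finset.sum_add_distrib,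
    Finset.mul_sum, Finset.mul_sum]
  refine Finset.sum_congr rfl fun τ' _ => ?_
  linear_combination f τ' * ww_key K k τ τ'

lemma V2_CC {n : ℕ} (K : ℝ) (x : Fin n → ℂ) :
    V2 K * CC x = Complex.tanh K • (CC x * V2 K) := by
  refine LinearMap.ext fun f => ?_
  have h : ∀ f, CC x f = ∑ k, x k • (RR k k f + RR k (k+1) f) := by
    intro f
    simp [CC, PP, QQ, LinearMap.sum_apply, Finset.sum_add_distrib, smul_add]
  simp only [Module.End.mul_apply, LinearMap.smul_apply, h, map_sum, map_smul, map_add, V2_RR,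
    Finset.smul_sum]
  refine Finset.sum_congr rfl fun k _ => smul_comm _ _ _

lemma V2_Om {n : ℕ} (K : ℝ) : V2 K (Om n) = ((2 * Complex.cosh K) ^ n) • Om n := by
  funext τ
  simp only [V2_apply, ww, Om, mul_one, Pi.smul_apply, smul_eq_mul]
  have := (Finset.prod_univ_sum (fun _ : Fin n => (Finset.univ : Finset Bool))
    (fun k b => Complex.exp (K * (csp (τ k) * csp b)))).symm
  simp only [Fintype.piFinset_univ] at this
  rw [this]
  have e1 : Complex.exp K = Complex.cosh K + Complex.sinh K := (Complex.cosh_add_sinh _).symm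
  have e2 : Complex.exp (-K) = Complex.cosh K - Complex.sinh K := (Complex.cosh_sub_sinh _).symm
  have : ∀ k, ∑ b : Bool, Complex.exp (K * (csp (τ k) * csp b)) = 2 * Complex.cosh K := by
    intro k
    rw [Fintype.sum_bool]
    cases τ k <;> simp only [csp, Bool.false_eq_true, if_false, if_true, mul_one,
      one_mul, mul_neg, neg_neg, e1, e2] <;> ring
  rw [Finset.prod_congr rfl fun k _ => this k]
  simp

/-- parity -/
noncomputable def Par {n : ℕ} : Module.End ℂ (VS n) where
  toFun f := fun τ => f (flipB n τ)
  map_add' _ _ := rfl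
  map_smul' _ _ := rfl

lemma Par_apply {n : ℕ} (f : VS n) (τ : Row n) : Par f τ = f (flipB n τ) := rfl

lemma Par_RR {n : ℕ} (k : Fin n) (m : ℕ) : Par * RR k m = - (RR k m * Par) := by
  refine LinearMap.ext fun f => funext fun τ => ?_
  simp [Par_apply, RR_apply, csp_flipB, flipB_comm m n]

lemma Par_CC {n : ℕ} (x : Fin n → ℂ) : Par * CC x = - (CC x * Par) := by
  simp [CC, PP, QQ, mul_add, add_mul, Finset.mul_sum, Finset.sum_mul, Par_RR,
    Finset.sum_neg_distrib]; abel

lemma Par_Om {n : ℕ} : Par (Om n) = Om n := rfl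

end CI

namespace CI
open Complex

lemma geo (n : ℕ) (r : ℤ) (h : ¬ (n : ℤ) ∣ r) :
    ∑ k : Fin n, exp (2 * Real.pi * I * (r / n) * (k : ℕ)) = 0 := by
  rcases Nat.eq_zero_or_pos n with rfl | hn
  · simp
  have hn' : (n : ℂ) ≠ 0 := by exact_mod_cast hn.ne'
  set z := exp (2 * Real.pi * I * (r / n)) with hz
  have h1 : z ^ n = 1 := by
    rw [hz, ← Complex.exp_nat_mul, Complex.exp_eq_one_iff]
    exact ⟨r, by field_simp⟩
  have h2 : z ≠ 1 := by
    rw [hz, Ne, Complex.exp_eq_one_iff]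
    rintro ⟨m, hm⟩
    apply h
    refine ⟨m, ?_⟩
    have h2pi : (2 * Real.pi * I : ℂ) ≠ 0 := Complex.two_pi_I_ne_zero
    have : (r / n : ℂ) = m := by
      apply mul_left_cancel₀ h2pi; rw [hm]; ring
    have : (r : ℂ) = n * m := by rw [← this]; field_simp
    exact_mod_cast this
  have h3 : ∀ k : Fin n, exp (2 * Real.pi * I * (r / n) * (k : ℕ)) = z ^ (k : ℕ) := by
    intro k; rw [hz, ← Complex.exp_nat_mul]; ring_nf
  simp_rw [h3]
  rw [Fin.sum_univ_eq_sum_range (fun k => z ^ k) n]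
  have := geom_sum_mul z n
  rw [h1, sub_self] at this
  exact (mul_eq_zero.mp this).resolve_right (sub_ne_zero.mpr h2)

/-- momenta -/
noncomputable def qq (N : ℕ) (j : ℕ) : ℝ := (2 * j + 1) * Real.pi / (2 * N)

/-- plane waves -/
noncomputable def ee (N : ℕ) (j : Fin N) : Fin (2 * N) → ℂ := fun k => exp (I * qq N j * (k : ℕ))
/-- plane waves -/
noncomputable def ff (N : ℕ) (j : Fin N) : Fin (2 * N) → ℂ :=
  fun k => exp (-(I * qq N j * (k : ℕ)))

lemma ee_ee (N : ℕ) (i j : Fin N) : ∑ k, ee N i k * ee N j k = 0 := by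
  have hN : (N : ℂ) ≠ 0 := by have := i.pos; exact_mod_cast this.ne'
  rw [← geo (2 * N) ((i : ℤ) + j + 1)]
  · refine Finset.sum_congr rfl fun k _ => ?_
    rw [ee, ee, ← Complex.exp_add]; congr 1
    simp only [qq]; push_cast; field_simp; ring
  · intro h
    have := Int.le_of_dvd (by omega) h
    push_cast at this
    omega

lemma ff_ff (N : ℕ) (i j : Fin N) : ∑ k, ff N i k * ff N j k = 0 := by
  have hN : (N : ℂ) ≠ 0 := by have := i.pos; exact_mod_cast this.ne'
  rw [← geo (2 * N) (-((i : ℤ) + j + 1))]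
  · refine Finset.sum_congr rfl fun k _ => ?_
    rw [ff, ff, ← Complex.exp_add]; congr 1
    simp only [qq]; push_cast; field_simp; ring
  · intro h
    rw [dvd_neg] at h
    have := Int.le_of_dvd (by omega) h
    push_cast at this
    omega

lemma ee_ff_self (N : ℕ) (i : Fin N) : ∑ k, ee N i k * ff N i k = 2 * N := by
  have : ∀ k, ee N i k * ff N i k = 1 := by
    intro k; rw [ee, ff, ← Complex.exp_add]; simp
  simp [this]

lemma ee_ff (N : ℕ) (i j : Fin N) (hij : i ≠ j) : ∑ k, ee N i k * ff N j k = 0 := by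
  have hN : (N : ℂ) ≠ 0 := by have := i.pos; exact_mod_cast this.ne'
  rw [← geo (2 * N) ((i : ℤ) - j)]
  · refine Finset.sum_congr rfl fun k _ => ?_
    rw [ee, ff, ← Complex.exp_add]; congr 1
    simp only [qq]; push_cast; field_simp; ring
  · intro h
    have h0 : (i : ℤ) - j ≠ 0 := fun h0 => hij (Fin.ext (by omega))
    have := Int.eq_zero_of_abs_lt_dvd h (by
      rw [abs_lt]; push_cast; constructor <;> omega)
    exact h0 this

lemma dirich (N : ℕ) (θ : ℝ) :
    (∑ j ∈ Finset.range N, 2 * Real.cos ((2 * j + 1) * θ)) * Real.sin θ = Real.sin (2 * N * θ) := by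
  induction N with
  | zero => simp
  | succ N ih =>
    rw [Finset.sum_range_succ, add_mul, ih]
    have h1 : ((2 : ℝ) * ((N + 1 : ℕ) : ℝ)) * θ = (2 * N + 1) * θ + θ := by push_cast; ring
    have h2 : ((2 : ℝ) * N) * θ = (2 * N + 1) * θ - θ := by ring
    rw [h1, h2, Real.sin_add, Real.sin_sub]; ring

/-- successor on the circle -/
def nx {n : ℕ} (k : Fin n) : Fin n := ⟨((k : ℕ) + 1) % n, Nat.mod_lt _ k.pos⟩

lemma kern (N : ℕ) (k l : Fin (2 * N)) :
    ∑ j : Fin N, (exp (I * qq N j) * (ee N j k * ff N j l) +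
      exp (-(I * qq N j)) * (ff N j k * ee N j l)) =
    if l = nx k then (if (k : ℕ) + 1 < 2 * N then (2 * N : ℂ) else - (2 * N)) else 0 := by
  have hNpos : 0 < N := by have := k.pos; omega
  have hNR : (N : ℝ) ≠ 0 := by exact_mod_cast hNpos.ne'
  have hN : (N : ℂ) ≠ 0 := by exact_mod_cast hNpos.ne'
  set d : ℝ := (k : ℝ) + 1 - l with hd
  have h1 : ∀ j : Fin N, exp (I * qq N j) * (ee N j k * ff N j l) +
      exp (-(I * qq N j)) * (ff N j k * ee N j l) =
      ((2 * Real.cos ((2 * (j : ℕ) + 1) * (d * Real.pi / (2 * N))) : ℝ) : ℂ) := by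
    intro j
    push_cast
    rw [Complex.two_cos]
    simp only [ee, ff, ← Complex.exp_add]
    congr 2 <;> simp only [qq, hd] <;> push_cast <;> field_simp <;> ring
  simp_rw [h1]
  rw [← Complex.ofReal_sum, Fin.sum_univ_eq_sum_range
    (fun j : ℕ => 2 * Real.cos ((2 * (j : ℝ) + 1) * (d * Real.pi / (2 * N))))]
  by_cases hl : l = nx k
  · rw [if_pos hl]
    by_cases hk : (k : ℕ) + 1 < 2 * N
    · rw [if_pos hk]
      have : (l : ℕ) = k + 1 := by rw [hl]; simp [nx, Nat.mod_eq_of_lt hk]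
      have hd0 : d = 0 := by rw [hd, this]; push_cast; ring
      rw [hd0]; simp; ring
    · rw [if_neg hk]
      have hk' : (k : ℕ) + 1 = 2 * N := by omega
      have : (l : ℕ) = 0 := by rw [hl]; simp [nx, hk']
      have hd0 : d = 2 * N := by
        rw [hd, this]; have : ((k : ℝ) + 1) = 2 * N := by exact_mod_cast hk'
        rw [this]; simp
      rw [hd0]
      have : ∀ j : ℕ, Real.cos ((2 * (j : ℝ) + 1) * (2 * N * Real.pi / (2 * N))) = -1 := by
        intro j
        have : (2 * (j : ℝ) + 1) * (2 * N * Real.pi / (2 * N)) = Real.pi + j * (2 * Real.pi) := by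
          field_simp; ring
        rw [this, Real.cos_add_nat_mul_two_pi, Real.cos_pi]
      simp [this]; ring
  · rw [if_neg hl]
    have h := dirich N (d * Real.pi / (2 * N))
    have hs : Real.sin (2 * N * (d * Real.pi / (2 * N))) = 0 := by
      have : (2 * N * (d * Real.pi / (2 * N))) = (((k : ℤ) + 1 - l : ℤ) : ℝ) * Real.pi := by
        rw [hd]; push_cast; field_simp
      rw [this, Real.sin_int_mul_pi]
    rw [hs] at h
    have hne : Real.sin (d * Real.pi / (2 * N)) ≠ 0 := by
      rw [Real.sin_ne_zero_iff]
      intro m hm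
      have h2 : (m : ℝ) * (2 * N) = d := by
        have hpi := Real.pi_ne_zero
        field_simp at hm
        linarith
      have h3 : m * (2 * N) = (k : ℤ) + 1 - l := by
        rw [hd] at h2; exact_mod_cast h2
      have hk := k.isLt
      have hl' := l.isLt
      apply hl
      apply Fin.ext
      simp only [nx]
      have hm0 : m = 0 ∨ m = 1 := by
        have : -1 < m := by nlinarith
        have : m < 2 := by nlinarith
        omega
      rcases hm0 with rfl | rfl
      · have : (l : ℕ) = k + 1 := by omega
        rw [Nat.mod_eq_of_lt (by omega)]; exact this
      · have : (k : ℕ) + 1 = 2 * N := by omega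
        rw [this, Nat.mod_self]; omega
    have := (mul_eq_zero.mp h).resolve_right hne
    rw [this]; simp

/-- sector Hamiltonian -/
noncomputable def hh (N : ℕ) (j : Fin N) : Module.End ℂ (VS (2 * N)) :=
  (1 / (2 * N : ℂ)) • (exp (I * qq N j) • (QQ (ee N j) * PP (ff N j)) +
    exp (-(I * qq N j)) • (QQ (ff N j) * PP (ee N j)))

/-- row energy -/
noncomputable def hrow {n : ℕ} (τ : Row n) : ℂ := ∑ k, csp (τ k) * csp (τ (nx k))

lemma QP_expand {n : ℕ} (x y : Fin n → ℂ) :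
    QQ x * PP y = ∑ k, ∑ l, (x k * y l) • (RR k (k + 1) * RR l l) := by
  rw [QQ, PP, Finset.sum_mul_sum]
  simp_rw [smul_mul_smul_comm]

lemma sum_hh (N : ℕ) : ∑ j, hh N j = ∑ k : Fin (2 * N),
    (if (k : ℕ) + 1 < 2 * N then (1 : ℂ) else -1) • (RR k (k + 1) * RR (nx k) (nx k : ℕ)) := by
  rcases Nat.eq_zero_or_pos N with rfl | hNpos
  · simp
  have hN : (N : ℂ) ≠ 0 := by exact_mod_cast hNpos.ne'
  have h1 : ∀ j, hh N j = ∑ k, ∑ l, ((1 / (2 * N : ℂ)) *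
      (exp (I * qq N j) * (ee N j k * ff N j l) +
      exp (-(I * qq N j)) * (ff N j k * ee N j l))) • (RR k (k + 1) * RR l l) := by
    intro j
    rw [hh, QP_expand, QP_expand]
    simp_rw [Finset.smul_sum, ← Finset.sum_add_distrib, Finset.smul_sum, smul_smul, ← add_smul, smul_smul]
  simp_rw [h1]
  rw [Finset.sum_comm]
  refine Finset.sum_congr rfl fun k _ => ?_
  rw [Finset.sum_comm]
  simp_rw [← Finset.sum_smul, ← Finset.mul_sum, kern]
  rw [Finset.sum_eq_single (nx k)]
  · rw [if_pos rfl]; congr 1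
    split_ifs <;> field_simp
  · intro l _ hl; simp [hl]
  · simp

lemma sum_hh_apply (N : ℕ) (f : VS (2 * N)) (hf : Par f = f) (τ : Row (2 * N)) :
    (∑ j, hh N j) f τ = hrow τ * f τ := by
  rw [sum_hh, hrow, Finset.sum_mul, LinearMap.sum_apply, Finset.sum_apply]
  refine Finset.sum_congr rfl fun k _ => ?_
  have hk := k.isLt
  simp only [LinearMap.smul_apply, Module.End.mul_apply, Pi.smul_apply, RR_apply, smul_eq_mul]
  by_cases h : (k : ℕ) + 1 < 2 * N
  · have : ((nx k : Fin (2 * N)) : ℕ) = k + 1 := by simp [nx, Nat.mod_eq_of_lt h]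
    rw [csp_flipB, this, flipB_flipB]; simp [h]; ring
  · have hk' : (k : ℕ) + 1 = 2 * N := by omega
    have : ((nx k : Fin (2 * N)) : ℕ) = 0 := by simp [nx, hk']
    have hfτ : f (flipB (2 * N) τ) = f τ := congrFun hf τ
    rw [csp_flipB, this, flipB_zero, hk', hfτ]
    have hN : 0 < N := by omega
    simp [hN]; ring

end CI

namespace CI
open Complex

lemma comm4 {E : Type*} [Ring E] {a b c d : E} (h1 : a * c + c * a = 0) (h2 : a * d + d * a = 0)
    (h3 : b * c + c * b = 0) (h4 : b * d + d * b = 0) : Commute (a * b) (c * d) := by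
  have h1' : a * c = - (c * a) := eq_neg_of_add_eq_zero_left h1
  have h2' : a * d = - (d * a) := eq_neg_of_add_eq_zero_left h2
  have h3' : b * c = - (c * b) := eq_neg_of_add_eq_zero_left h3
  have h4' : b * d = - (d * b) := eq_neg_of_add_eq_zero_left h4
  show a * b * (c * d) = c * d * (a * b)
  calc a * b * (c * d) = a * (b * c) * d := by noncomm_ring
    _ = - ((a * c) * (b * d)) := by rw [h3']; noncomm_ring
    _ = - (c * (a * d) * b) := by rw [h1', h4']; noncomm_ring
    _ = c * d * (a * b) := by rw [h2']; noncomm_ring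

lemma comm_neg {E : Type*} [Ring E] {a b c : E} (h1 : a * b = - (b * a))
    (h2 : a * c = - (c * a)) : Commute a (b * c) := by
  show a * (b * c) = b * c * a
  rw [← mul_assoc, h1, neg_mul, mul_assoc, h2]; noncomm_ring

/-- pair creation -/
noncomputable def BB (N : ℕ) (j : Fin N) : Module.End ℂ (VS (2 * N)) :=
  (I / (8 * N : ℂ)) • (CC (ee N j) * CC (ff N j))

lemma QQ_PP {n : ℕ} (x y : Fin n → ℂ) :
    QQ x * PP y + PP y * QQ x = (0 : Module.End ℂ (VS n)) := by
  rw [add_comm, PP_QQ]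

lemma CC_CC {n : ℕ} (x y : Fin n → ℂ) (h : ∑ k, x k * y k = 0) :
    CC x * CC y + CC y * CC x = (0 : Module.End ℂ (VS n)) := by
  have h1 := PP_PP x y
  have h2 := QQ_QQ x y
  have h3 := PP_QQ x y
  have h4 := QQ_PP x y
  rw [h] at h1 h2
  simp only [mul_zero, zero_smul] at h1 h2
  calc CC x * CC y + CC y * CC x = (PP x * PP y + PP y * PP x) + (QQ x * QQ y + QQ y * QQ x) +
      (PP x * QQ y + QQ y * PP x) + (QQ x * PP y + PP y * QQ x) := by simp only [CC]; noncomm_ring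
    _ = 0 := by rw [h1, h2, h3, h4]; simp

lemma PP_CC {n : ℕ} (x y : Fin n → ℂ) (h : ∑ k, x k * y k = 0) :
    PP x * CC y + CC y * PP x = (0 : Module.End ℂ (VS n)) := by
  have h1 := PP_PP x y
  have h3 := PP_QQ x y
  rw [h] at h1
  simp only [mul_zero, zero_smul] at h1
  calc PP x * CC y + CC y * PP x = (PP x * PP y + PP y * PP x) +
      (PP x * QQ y + QQ y * PP x) := by simp only [CC]; noncomm_ring
    _ = 0 := by rw [h1, h3]; simp

lemma QQ_CC {n : ℕ} (x y : Fin n → ℂ) (h : ∑ k, x k * y k = 0) :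
    QQ x * CC y + CC y * QQ x = (0 : Module.End ℂ (VS n)) := by
  have h1 := QQ_QQ x y
  have h3 := QQ_PP x y
  rw [h] at h1
  simp only [mul_zero, zero_smul] at h1
  calc QQ x * CC y + CC y * QQ x = (QQ x * QQ y + QQ y * QQ x) +
      (QQ x * PP y + PP y * QQ x) := by simp only [CC]; noncomm_ring
    _ = 0 := by rw [h1, h3]; simp

lemma ff_ee (N : ℕ) (i j : Fin N) (hij : i ≠ j) : ∑ k, ff N i k * ee N j k = 0 := by
  rw [← ee_ff N j i hij.symm]; exact Finset.sum_congr rfl fun _ _ => mul_comm _ _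

lemma BB_comm (N : ℕ) (i j : Fin N) : Commute (BB N i) (BB N j) := by
  rcases eq_or_ne i j with rfl | hij
  · exact Commute.refl _
  unfold BB
  refine Commute.smul_left (Commute.smul_right (comm4 ?_ ?_ ?_ ?_) _) _ <;> apply CC_CC
  · exact ee_ee _ _ _
  · exact ee_ff _ _ _ hij
  · exact ff_ee _ _ _ hij
  · exact ff_ff _ _ _

lemma hh_BB_comm (N : ℕ) (i j : Fin N) (hij : i ≠ j) : Commute (hh N i) (BB N j) := by
  have q1 := QQ_CC _ _ (ee_ee N i j)
  have q2 := QQ_CC _ _ (ee_ff N i j hij)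
  have q3 := QQ_CC _ _ (ff_ee N i j hij)
  have q4 := QQ_CC _ _ (ff_ff N i j)
  have p1 := PP_CC _ _ (ee_ee N i j)
  have p2 := PP_CC _ _ (ee_ff N i j hij)
  have p3 := PP_CC _ _ (ff_ee N i j hij)
  have p4 := PP_CC _ _ (ff_ff N i j)
  have c1 := comm4 q1 q2 p3 p4
  have c2 := comm4 q3 q4 p1 p2
  unfold hh BB
  exact ((c1.smul_left _).add_left (c2.smul_left _)).smul_left _ |>.smul_right _

lemma Par_BB (N : ℕ) (j : Fin N) : Commute Par (BB N j) := by
  unfold BB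
  refine Commute.smul_right ?_ _
  exact comm_neg (Par_CC _) (Par_CC _)

lemma V2_BB (N : ℕ) (K : ℝ) (j : Fin N) :
    V2 K * BB N j = (Complex.tanh K) ^ 2 • (BB N j * V2 K) := by
  unfold BB
  rw [mul_smul_comm, ← mul_assoc, V2_CC, smul_mul_assoc, mul_assoc, V2_CC, mul_smul_comm,
    smul_mul_assoc, mul_assoc]
  module

lemma ev_BB (N : ℕ) (j : Fin N) (f : VS (2 * N)) : ev (BB N j f) = 0 := by
  unfold BB
  rw [LinearMap.smul_apply, map_smul, Module.End.mul_apply, ev_CC, smul_zero]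

section sector
variable (N : ℕ) (j : Fin N)

lemma sec_W : ∃ W : VS (2 * N),
    BB N j (Om _) = (I / (2 * N)) • (W - (2 * N : ℂ) • Om _) ∧
    hh N j (Om _) = (1 / (2 * N : ℂ)) • (exp (I * qq N j) • (W - (4 * N : ℂ) • Om _) -
      exp (-(I * qq N j)) • W) ∧
    hh N j W = (2 * exp (I * qq N j)) • (W - (4 * N : ℂ) • Om _) := by
  have hN : (N : ℂ) ≠ 0 := by have := j.pos; exact_mod_cast this.ne'
  set p := PP (ee N j) with hp
  set p' := PP (ff N j) with hp'
  set q := QQ (ee N j) with hq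
  set q' := QQ (ff N j) with hq'
  set Ω := Om (2 * N) with hΩ
  have e1 : p Ω = q Ω := PP_Om _
  have e2 : p' Ω = q' Ω := PP_Om _
  have pp' : p * p' + p' * p = (4 * N : ℂ) • (1 : Module.End ℂ (VS (2 * N))) := by
    rw [hp, hp', PP_PP, ee_ff_self]; congr 1; ring
  have pp : p * p = 0 := by
    have := PP_PP (ee N j) (ee N j)
    rw [ee_ee] at this
    simp only [mul_zero, zero_smul] at this
    rw [← two_smul ℂ] at this
    exact (smul_eq_zero.mp this).resolve_left two_ne_zero
  have pp2 : p' * p' = 0 := by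
    have := PP_PP (ff N j) (ff N j)
    rw [ff_ff] at this
    simp only [mul_zero, zero_smul] at this
    rw [← two_smul ℂ] at this
    exact (smul_eq_zero.mp this).resolve_left two_ne_zero
  have qp' : ∀ v, q (p' v) = - p' (q v) := fun v => by
    have := LinearMap.congr_fun (QQ_PP (ee N j) (ff N j)) v
    exact eq_neg_of_add_eq_zero_left this
  have q'p : ∀ v, q' (p v) = - p (q' v) := fun v => by
    have := LinearMap.congr_fun (QQ_PP (ff N j) (ee N j)) v
    exact eq_neg_of_add_eq_zero_left this
  have pp'v : ∀ v, p' (p v) = (4 * N : ℂ) • v - p (p' v) := fun v => by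
    have := LinearMap.congr_fun pp' v
    exact eq_sub_of_add_eq' this
  have ppv : ∀ v, p (p v) = 0 := fun v => LinearMap.congr_fun pp v
  have pp2v : ∀ v, p' (p' v) = 0 := fun v => LinearMap.congr_fun pp2 v
  have r1 : q (p' Ω) = p (p' Ω) - (4 * N : ℂ) • Ω := by
    rw [qp', ← e1, pp'v]; abel
  have r2 : q' (p Ω) = - p (p' Ω) := by rw [q'p, ← e2]
  refine ⟨p (p' Ω), ?_, ?_, ?_⟩
  · have : BB N j Ω = (I / (8 * N : ℂ)) • (p (p' Ω + q' Ω) + q (p' Ω + q' Ω)) := by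
      simp [BB, CC, hp, hp', hq, hq']
    rw [this, ← e2, ← two_smul ℂ (p' Ω), map_smul, map_smul, r1]
    have : (8 * N : ℂ) = 4 * (2 * N) := by ring
    module
  · have : hh N j Ω = (1 / (2 * N : ℂ)) • (exp (I * qq N j) • q (p' Ω) +
      exp (-(I * qq N j)) • q' (p Ω)) := by
      simp [hh, hp, hp', hq, hq']
    rw [this, r1, r2]; module
  · have : hh N j (p (p' Ω)) = (1 / (2 * N : ℂ)) • (exp (I * qq N j) • q (p' (p (p' Ω))) +
      exp (-(I * qq N j)) • q' (p (p (p' Ω)))) := by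
      simp [hh, hp, hp', hq, hq']
    rw [this, ppv, pp'v, pp2v, map_zero, map_zero, sub_zero, map_smul, r1, smul_zero, add_zero,
      smul_smul, smul_smul]
    congr 1; field_simp; ring

lemma hh_Om : hh N j (Om _) = (-2 * Complex.cos (qq N j)) • Om _ +
    (2 * Complex.sin (qq N j)) • BB N j (Om _) := by
  have hN : (N : ℂ) ≠ 0 := by have := j.pos; exact_mod_cast this.ne'
  obtain ⟨W, h1, h2, h3⟩ := sec_W N j
  have ha : exp (I * qq N j) = Complex.cos (qq N j) + Complex.sin (qq N j) * I := by
    rw [mul_comm, Complex.exp_mul_I]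
  have hb : exp (-(I * qq N j)) = Complex.cos (qq N j) - Complex.sin (qq N j) * I := by
    rw [mul_comm, ← neg_mul, Complex.exp_mul_I]; simp; ring
  rw [h1, h2, ha, hb]
  generalize Complex.cos (qq N j : ℂ) = c
  generalize Complex.sin (qq N j : ℂ) = s
  match_scalars <;> field_simp <;> ring

lemma hh_BB_Om : hh N j (BB N j (Om _)) = (2 * Complex.sin (qq N j)) • Om _ +
    (2 * Complex.cos (qq N j)) • BB N j (Om _) := by
  have hN : (N : ℂ) ≠ 0 := by have := j.pos; exact_mod_cast this.ne'
  obtain ⟨W, h1, h2, h3⟩ := sec_W N j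
  have ha : exp (I * qq N j) = Complex.cos (qq N j) + Complex.sin (qq N j) * I := by
    rw [mul_comm, Complex.exp_mul_I]
  have hb : exp (-(I * qq N j)) = Complex.cos (qq N j) - Complex.sin (qq N j) * I := by
    rw [mul_comm, ← neg_mul, Complex.exp_mul_I]; simp; ring
  rw [h1, map_smul, map_sub, map_smul, h2, h3, ha, hb]
  generalize Complex.cos (qq N j : ℂ) = c
  generalize Complex.sin (qq N j : ℂ) = s
  have hI : I ^ 2 = -1 := Complex.I_sq
  match_scalars <;> field_simp
  · ring
  · linear_combination (-4 * s) * hI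

end sector

end CI

namespace CI
open Complex

lemma exists_theta {ι : Type*} {E : Type*} [Ring E] [Algebra ℂ E] (B : ι → E)
    (hB : ∀ i j, Commute (B i) (B j)) :
    ∃ Θ : MvPolynomial ι ℂ →ₐ[ℂ] E, ∀ i, Θ (MvPolynomial.X i) = B i := by
  have hcomm : IsMulCommutative (Algebra.adjoin ℂ (Set.range B)) :=
    Algebra.isMulCommutative_adjoin ℂ (by
    rintro _ ⟨i, rfl⟩ _ ⟨j, rfl⟩; exact hB i j)
  let _ : CommRing (Algebra.adjoin ℂ (Set.range B)) :=
    { (inferInstance : Ring (Algebra.adjoin ℂ (Set.range B))) with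
      mul_comm := hcomm.is_comm.comm }
  let g : ι → Algebra.adjoin ℂ (Set.range B) := fun i => ⟨B i, Algebra.subset_adjoin ⟨i, rfl⟩⟩
  refine ⟨(Algebra.adjoin ℂ (Set.range B)).val.comp (MvPolynomial.aeval g), fun i => ?_⟩
  simp [g]

/-- the algebra map -/
noncomputable def Th (N : ℕ) : MvPolynomial (Fin N) ℂ →ₐ[ℂ] Module.End ℂ (VS (2 * N)) :=
  (exists_theta (BB N) (BB_comm N)).choose

lemma Th_X (N : ℕ) (j : Fin N) : Th N (MvPolynomial.X j) = BB N j :=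
  (exists_theta (BB N) (BB_comm N)).choose_spec j

/-- linear factor -/
noncomputable def lf {N : ℕ} (j : Fin N) (a : ℂ × ℂ) : MvPolynomial (Fin N) ℂ :=
  MvPolynomial.C a.1 + MvPolynomial.C a.2 * MvPolynomial.X j

lemma Th_lf {N : ℕ} (j : Fin N) (a : ℂ × ℂ) : Th N (lf j a) = a.1 • 1 + a.2 • BB N j := by
  rw [lf, map_add, map_mul, Th_X, ← MvPolynomial.algebraMap_eq, AlgHom.commutes, AlgHom.commutes,
    Algebra.algebraMap_eq_smul_one, Algebra.algebraMap_eq_smul_one, smul_one_mul]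

/-- product states -/
noncomputable def Psi (N : ℕ) (α : Fin N → ℂ × ℂ) : VS (2 * N) := Th N (∏ j, lf j (α j)) (Om _)

lemma Par_Th (N : ℕ) (p : MvPolynomial (Fin N) ℂ) : Commute Par (Th N p) := by
  induction p using MvPolynomial.induction_on with
  | C a => rw [← MvPolynomial.algebraMap_eq, AlgHom.commutes]; exact (Algebra.commutes _ _).symm
  | add p q hp hq => rw [map_add]; exact hp.add_right hq
  | mul_X p j hp => rw [map_mul, Th_X]; exact hp.mul_right (Par_BB N j)

lemma Par_Psi (N : ℕ) (α : Fin N → ℂ × ℂ) : Par (Psi N α) = Psi N α := by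
  exact LinearMap.congr_fun (Par_Th N (∏ j, lf j (α j))).eq (Om _)

lemma ev_Th (N : ℕ) (p : MvPolynomial (Fin N) ℂ) :
    ev (Th N p (Om _)) = 2 ^ (2 * N) * MvPolynomial.constantCoeff p := by
  induction p using MvPolynomial.induction_on with
  | C a =>
    rw [← MvPolynomial.algebraMap_eq, AlgHom.commutes]
    simp [ev, Om, Algebra.algebraMap_eq_smul_one, MvPolynomial.algebraMap_eq, mul_comm]
  | add p q hp hq => rw [map_add, LinearMap.add_apply, map_add, hp, hq, map_add]; ring
  | mul_X p j hp =>
    rw [mul_comm p, map_mul, Th_X, Module.End.mul_apply, ev_BB]; simp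

lemma ev_Psi (N : ℕ) (α : Fin N → ℂ × ℂ) : ev (Psi N α) = 2 ^ (2 * N) * ∏ j, (α j).1 := by
  rw [Psi, ev_Th, map_prod]; congr 1
  refine Finset.prod_congr rfl fun j _ => ?_
  simp [lf]

lemma V2_lf (N : ℕ) (K : ℝ) (j : Fin N) (a : ℂ × ℂ) :
    V2 K * Th N (lf j a) = Th N (lf j (a.1, (Complex.tanh K) ^ 2 * a.2)) * V2 K := by
  rw [Th_lf, Th_lf, mul_add, add_mul, mul_smul_comm, mul_smul_comm, V2_BB, smul_mul_assoc,
    smul_mul_assoc, mul_one, one_mul, smul_smul]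
  simp [mul_comm]

lemma V2_Psi (N : ℕ) (K : ℝ) (α : Fin N → ℂ × ℂ) :
    V2 K (Psi N α) = Psi N (fun j => (4 * Complex.cosh K ^ 2 * (α j).1,
      4 * Complex.sinh K ^ 2 * (α j).2)) := by
  have hc : Complex.cosh (K : ℂ) ≠ 0 := by
    rw [← Complex.ofReal_cosh]; exact_mod_cast (Real.cosh_pos K).ne'
  have h1 : ∀ s : Finset (Fin N), V2 K * Th N (∏ j ∈ s, lf j (α j)) =
      Th N (∏ j ∈ s, lf j ((α j).1, (Complex.tanh K) ^ 2 * (α j).2)) * V2 K := by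
    intro s
    induction s using Finset.induction_on with
    | empty => simp
    | insert j s hj ih =>
      rw [Finset.prod_insert hj, Finset.prod_insert hj, map_mul, map_mul, ← mul_assoc, V2_lf,
        mul_assoc, ih, mul_assoc]
  have h2 := LinearMap.congr_fun (h1 Finset.univ) (Om _)
  rw [Module.End.mul_apply, Module.End.mul_apply, V2_Om, map_smul] at h2
  rw [Psi, h2, Psi, ← LinearMap.smul_apply, ← map_smul]
  congr 2
  have : ∀ j : Fin N, lf j (4 * Complex.cosh K ^ 2 * (α j).1, 4 * Complex.sinh K ^ 2 * (α j).2) =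
      MvPolynomial.C ((2 * Complex.cosh K) ^ 2) *
        lf j ((α j).1, (Complex.tanh K) ^ 2 * (α j).2) := by
    intro j
    simp only [lf]
    rw [mul_add, ← mul_assoc, ← MvPolynomial.C_mul, ← MvPolynomial.C_mul,
      Complex.tanh_eq_sinh_div_cosh]
    congr 2
    · ring_nf
    · congr 1; field_simp; ring
  simp_rw [this]
  rw [Finset.prod_mul_distrib, MvPolynomial.smul_eq_C_mul]
  simp [pow_mul]

/-- horizontal transfer matrix -/
noncomputable def V1 {n : ℕ} (K : ℝ) : Module.End ℂ (VS n) where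
  toFun f := fun τ => exp (K * hrow τ) * f τ
  map_add' f g := by funext τ; simp [mul_add]
  map_smul' c f := by funext τ; simp; ring

lemma V1_eig {n : ℕ} (K : ℝ) (f : VS n) (lam : ℂ) (h : ∀ τ, hrow τ * f τ = lam * f τ) :
    V1 K f = exp (K * lam) • f := by
  funext τ
  show exp (K * hrow τ) * f τ = exp (K * lam) * f τ
  rcases eq_or_ne (f τ) 0 with h0 | h0
  · simp [h0]
  · rw [mul_right_cancel₀ h0 (h τ)]

lemma hh_lf (N : ℕ) (j : Fin N) (a : ℂ × ℂ) (lam : ℂ)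
    (h1 : -2 * Complex.cos (qq N j) * a.1 + 2 * Complex.sin (qq N j) * a.2 = lam * a.1)
    (h2 : 2 * Complex.sin (qq N j) * a.1 + 2 * Complex.cos (qq N j) * a.2 = lam * a.2) :
    hh N j (Th N (lf j a) (Om _)) = lam • Th N (lf j a) (Om _) := by
  rw [Th_lf]
  simp only [LinearMap.add_apply, LinearMap.smul_apply, Module.End.one_apply, map_add, map_smul,
    hh_Om, hh_BB_Om]
  match_scalars
  · linear_combination h1
  · linear_combination h2

lemma hh_Psi (N : ℕ) (j : Fin N) (α : Fin N → ℂ × ℂ) (lam : ℂ)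
    (h1 : -2 * Complex.cos (qq N j) * (α j).1 + 2 * Complex.sin (qq N j) * (α j).2
      = lam * (α j).1)
    (h2 : 2 * Complex.sin (qq N j) * (α j).1 + 2 * Complex.cos (qq N j) * (α j).2
      = lam * (α j).2) :
    hh N j (Psi N α) = lam • Psi N α := by
  have hc : ∀ s : Finset (Fin N), j ∉ s → Commute (hh N j) (Th N (∏ i ∈ s, lf i (α i))) := by
    intro s
    induction s using Finset.induction_on with
    | empty => intro _; simp
    | insert i s hi ih =>
      intro hj
      rw [Finset.mem_insert, not_or] at hj
      rw [Finset.prod_insert hi, map_mul]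
      refine Commute.mul_right ?_ (ih hj.2)
      rw [Th_lf]
      exact ((Commute.one_right _).smul_right _).add_right ((hh_BB_comm N j i hj.1).smul_right _)
  rw [Psi, ← Finset.prod_erase_mul _ _ (Finset.mem_univ j), map_mul, Module.End.mul_apply,
    ← Module.End.mul_apply (hh N j), (hc _ (Finset.notMem_erase j _)).eq, Module.End.mul_apply,
    hh_lf N j (α j) lam h1 h2, map_smul]

/-- eigen-pairs -/
noncomputable def eg (N : ℕ) (j : Fin N) (b : Bool) : ℂ × ℂ :=
  if b then (Complex.sin (qq N j / 2), Complex.cos (qq N j / 2))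
  else (Complex.cos (qq N j / 2), - Complex.sin (qq N j / 2))

/-- eigenvalue -/
noncomputable def el (b : Bool) : ℂ := if b then 2 else -2

lemma V1_Psi_eg (N : ℕ) (K : ℝ) (b : Fin N → Bool) :
    V1 K (Psi N (fun j => eg N j (b j))) =
      (∏ j, exp (K * el (b j))) • Psi N (fun j => eg N j (b j)) := by
  rw [← Complex.exp_sum, ← Finset.mul_sum]
  apply V1_eig
  intro τ
  rw [← sum_hh_apply N _ (Par_Psi N _) τ, LinearMap.sum_apply, Finset.sum_apply, Finset.sum_mul]
  refine Finset.sum_congr rfl fun j _ => ?_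
  rw [hh_Psi N j _ (el (b j))]
  · simp
  all_goals
    have hs := Complex.sin_sq_add_cos_sq (qq N j / 2)
    have h1 : Complex.cos (qq N j) = 2 * Complex.cos (qq N j / 2) ^ 2 - 1 := by
      rw [← Complex.cos_two_mul]; ring_nf
    have h2 : Complex.sin (qq N j) = 2 * Complex.sin (qq N j / 2) * Complex.cos (qq N j / 2) := by
      rw [← Complex.sin_two_mul]; ring_nf
    rw [h1, h2]
    unfold eg
    generalize Complex.cos (qq N j / 2) = c at *
    generalize Complex.sin (qq N j / 2) = s at *
    cases b j <;> simp only [el, if_true, if_false, Bool.false_eq_true] <;>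
      first | linear_combination (0 : ℂ) * hs | linear_combination (-4 * c) * hs | linear_combination (4 * c) * hs

lemma hmain {N : ℕ} (j : Fin N) (A B A1 B1 A2 B2 : ℂ) (hA : A1 + A2 = A) (hB : B1 + B2 = B) :
    (MvPolynomial.C A1 + MvPolynomial.C B1 * MvPolynomial.X j +
      (MvPolynomial.C A2 + MvPolynomial.C B2 * MvPolynomial.X j) : MvPolynomial (Fin N) ℂ) =
    MvPolynomial.C A + MvPolynomial.C B * MvPolynomial.X j := by
  rw [← hA, ← hB, MvPolynomial.C_add, MvPolynomial.C_add]; ring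

lemma V1_Psi (N : ℕ) (K : ℝ) (α : Fin N → ℂ × ℂ) :
    V1 K (Psi N α) = Psi N (fun j =>
      ((Complex.cosh (2 * K) - Complex.sinh (2 * K) * Complex.cos (qq N j)) * (α j).1 +
        Complex.sinh (2 * K) * Complex.sin (qq N j) * (α j).2,
       Complex.sinh (2 * K) * Complex.sin (qq N j) * (α j).1 +
       (Complex.cosh (2 * K) + Complex.sinh (2 * K) * Complex.cos (qq N j)) * (α j).2)) := by
  set cf : Fin N → Bool → ℂ := fun j b =>
    if b then (α j).1 * Complex.sin (qq N j / 2) + (α j).2 * Complex.cos (qq N j / 2)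
    else (α j).1 * Complex.cos (qq N j / 2) - (α j).2 * Complex.sin (qq N j / 2) with hcf
  have hs := fun j : Fin N => Complex.sin_sq_add_cos_sq (qq N j / 2)
  have key : ∀ d : Fin N → Bool → ℂ, Th N (∏ j, ∑ b : Bool, MvPolynomial.C (d j b) * lf j (eg N j b)) (Om _)
      = ∑ b : Fin N → Bool, (∏ j, d j (b j)) • Psi N (fun j => eg N j (b j)) := by
    intro d
    rw [Finset.prod_univ_sum, map_sum, LinearMap.sum_apply, Fintype.piFinset_univ]
    refine Finset.sum_congr rfl fun b _ => ?_
    rw [Finset.prod_mul_distrib, ← map_prod, ← MvPolynomial.smul_eq_C_mul, map_smul]; rfl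
  have e0 : Psi N α = Th N (∏ j, ∑ b : Bool, MvPolynomial.C (cf j b) * lf j (eg N j b)) (Om _) := by
    rw [Psi]; congr 2
    refine Finset.prod_congr rfl fun j _ => ?_
    rw [Fintype.sum_bool]
    simp only [lf, eg, hcf, if_true, if_false, Bool.false_eq_true, mul_add, ← mul_assoc,
      ← MvPolynomial.C_mul]
    have := hs j
    generalize Complex.cos (qq N j / 2) = c at *
    generalize Complex.sin (qq N j / 2) = s at *
    have a1 : (α j).1 = ((α j).1 * s + (α j).2 * c) * s + ((α j).1 * c - (α j).2 * s) * c := by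
      linear_combination (-(α j).1) * this
    have a2 : (α j).2 = ((α j).1 * s + (α j).2 * c) * c + ((α j).1 * c - (α j).2 * s) * (-s) := by
      linear_combination (-(α j).2) * this
    exact (hmain j _ _ _ _ _ _ a1.symm a2.symm).symm
  rw [e0, key, map_sum]
  have e1 : ∀ b : Fin N → Bool, V1 K ((∏ j, cf j (b j)) • Psi N (fun j => eg N j (b j))) =
      (∏ j, exp (K * el (b j)) * cf j (b j)) • Psi N (fun j => eg N j (b j)) := by
    intro b
    rw [map_smul, V1_Psi_eg, smul_smul, Finset.prod_mul_distrib, mul_comm (∏ j, cf j (b j))]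
  rw [Finset.sum_congr rfl fun b _ => e1 b, ← key (fun j b => exp (K * el b) * cf j b), Psi]
  congr 2
  refine Finset.prod_congr rfl fun j _ => ?_
  rw [Fintype.sum_bool]
  simp only [lf, eg, el, hcf, if_true, if_false, Bool.false_eq_true, mul_add, ← mul_assoc,
    ← MvPolynomial.C_mul]
  have h0 := hs j
  have h1 : Complex.cos (qq N j) = 2 * Complex.cos (qq N j / 2) ^ 2 - 1 := by
    rw [← Complex.cos_two_mul]; ring_nf
  have h2 : Complex.sin (qq N j) = 2 * Complex.sin (qq N j / 2) * Complex.cos (qq N j / 2) := by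
    rw [← Complex.sin_two_mul]; ring_nf
  have h3 : exp (K * 2) = Complex.cosh (2 * K) + Complex.sinh (2 * K) := by
    rw [Complex.cosh_add_sinh, mul_comm]
  have h4 : exp (K * -2) = Complex.cosh (2 * K) - Complex.sinh (2 * K) := by
    rw [Complex.cosh_sub_sinh]; ring_nf
  rw [h1, h2, h3, h4]
  generalize Complex.cos (qq N j / 2) = c at *
  generalize Complex.sin (qq N j / 2) = s at *
  generalize Complex.cosh (2 * K) = ch at *
  generalize Complex.sinh (2 * K) = sh at *
  have c2 : c ^ 2 = 1 - s ^ 2 := by linear_combination h0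
  apply hmain
  · linear_combination ((α j).1 * (ch + sh)) * h0
  · linear_combination ((α j).2 * (ch - sh)) * h0

end CI

namespace CI
open Complex

/-- minus energy of a stack of rows -/
noncomputable def WW {n : ℕ} (m : ℕ) (σ : Fin m → Row n) : ℂ :=
  ∑ j, hrow (σ j) + ∑ j : Fin m, ∑ k : Fin n,
    if h : (j : ℕ) + 1 < m then csp (σ j k) * csp (σ ⟨(j : ℕ) + 1, h⟩ k) else 0

lemma WW_one {n : ℕ} (σ : Fin 1 → Row n) : WW 1 σ = hrow (σ 0) := by
  simp [WW]

lemma WW_succ {n : ℕ} (m : ℕ) (τ : Row n) (σ : Fin (m + 1) → Row n) :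
    WW (m + 2) (Fin.cons τ σ : Fin (m + 2) → Row n) =
      hrow τ + ∑ k, csp (τ k) * csp (σ 0 k) + WW (m + 1) σ := by
  unfold WW
  rw [Fin.sum_univ_succ, Fin.sum_univ_succ (n := m + 1)]
  simp only [Fin.cons_zero, Fin.cons_succ]
  have h0 : ∑ k : Fin n, (if h : ((0 : Fin (m + 2)) : ℕ) + 1 < m + 2 then
      csp (τ k) * csp ((Fin.cons τ σ : Fin (m + 2) → Row n) ⟨((0 : Fin (m + 2)) : ℕ) + 1, h⟩ k)
      else 0) = ∑ k, csp (τ k) * csp (σ 0 k) := by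
    refine Finset.sum_congr rfl fun k _ => ?_
    rw [dif_pos (by simp)]
    rfl
  have h1 : ∀ j : Fin (m + 1), ∑ k : Fin n, (if h : ((Fin.succ j : Fin (m + 2)) : ℕ) + 1 < m + 2
      then csp (σ j k) *
        csp ((Fin.cons τ σ : Fin (m + 2) → Row n) ⟨((Fin.succ j : Fin (m + 2)) : ℕ) + 1, h⟩ k)
      else 0) = ∑ k : Fin n, if h : (j : ℕ) + 1 < m + 1 then
        csp (σ j k) * csp (σ ⟨(j : ℕ) + 1, h⟩ k) else 0 := by
    intro j
    refine Finset.sum_congr rfl fun k _ => ?_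
    by_cases h : (j : ℕ) + 1 < m + 1
    · rw [dif_pos (by simpa using h), dif_pos h]
      rfl
    · rw [dif_neg (by simpa using h), dif_neg h]
  rw [h0, Finset.sum_congr rfl fun j _ => h1 j]
  ring

/-- partial partition functions -/
noncomputable def Phi {n : ℕ} (K : ℝ) (m : ℕ) : VS n := fun τ =>
  ∑ σ : Fin m → Row n, exp (K * WW (m + 1) (Fin.cons τ σ : Fin (m + 1) → Row n))

lemma Phi_zero {n : ℕ} (K : ℝ) : (Phi K 0 : VS n) = V1 K (Om n) := by
  funext τ
  show ∑ σ : Fin 0 → Row n, exp (K * WW 1 (Fin.cons τ σ : Fin 1 → Row n)) = exp (K * hrow τ) * 1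
  simp [WW_one]

lemma Phi_succ {n : ℕ} (K : ℝ) (m : ℕ) : (Phi K (m + 1) : VS n) = V1 K (V2 K (Phi K m)) := by
  funext τ
  show _ = exp (K * hrow τ) * ∑ τ', ww K τ τ' * Phi K m τ'
  unfold Phi
  rw [← (Fin.consEquiv (fun _ : Fin (m + 1) => Row n)).sum_comp, Fintype.sum_prod_type,
    Finset.mul_sum]
  refine Finset.sum_congr rfl fun τ' _ => ?_
  rw [Finset.mul_sum, Finset.mul_sum]
  refine Finset.sum_congr rfl fun σ _ => ?_
  rw [WW_succ]
  simp only [Fin.consEquiv_apply, Fin.cons_zero, ww]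
  rw [← Complex.exp_sum, ← Complex.exp_add, ← Complex.exp_add, ← Finset.mul_sum]
  have e : (Fin.consEquiv (fun _ : Fin (m + 1) => Row n)) (τ', σ) = Fin.cons τ' σ := rfl
  rw [e]
  congr 1; ring

lemma sum_WW {n : ℕ} (K : ℝ) (m : ℕ) :
    ∑ σ : Fin (m + 1) → Row n, exp (K * WW (m + 1) σ) = ev (Phi K m : VS n) := by
  rw [← (Fin.consEquiv (fun _ : Fin (m + 1) => Row n)).sum_comp, Fintype.sum_prod_type]
  rfl

lemma csp_spin (b : Bool) : ((spin b : ℝ) : ℂ) = csp b := by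
  cases b <;> simp [spin, csp]

lemma energy_WW (M N : ℕ) (σ : Fin (2 * M) × Fin (2 * N) → Bool) :
    ((energy M N σ : ℝ) : ℂ) = - WW (2 * M) (fun j k => σ (j, k)) := by
  unfold energy WW hrow
  push_cast
  simp only [csp_spin, nx, apply_dite (fun x : ℝ => (x : ℂ)), Complex.ofReal_mul,
    Complex.ofReal_zero]
  ring

lemma Zpart_ev (M N m : ℕ) (hm : 2 * M = m + 1) (K : ℝ) :
    ((Zpart M N K : ℝ) : ℂ) = ev (Phi K m : VS (2 * N)) := by
  rw [← sum_WW, ← hm]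
  unfold Zpart
  push_cast
  rw [← (Equiv.curry (Fin (2 * M)) (Fin (2 * N)) Bool).sum_comp]
  refine Finset.sum_congr rfl fun σ _ => ?_
  rw [energy_WW]
  congr 1
  simp only [neg_mul, mul_neg, neg_neg]
  rfl

/-- the factor -/
noncomputable def Gf (m : ℕ) (C s c g : ℝ) : ℝ :=
  Real.cosh (m * g) + C * (1 / s - c) * (Real.sinh (m * g) / Real.sinh g)

lemma Psi_one (N : ℕ) : Psi N (fun _ => (1, 0)) = Om _ := by
  simp [Psi, lf]

lemma Phi_Psi (N : ℕ) (K : ℝ) (hK : 0 < K) (g : ℕ → ℝ) (m : ℕ)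
    (hg : ∀ j < N, Real.cosh (g j) = Real.sinh (2 * K) + 1 / Real.sinh (2 * K)
      - Real.cos (qq N j)) (hg0 : ∀ j < N, g j ≠ 0) :
    (Phi K m : VS (2 * N)) = Psi N (fun j =>
      (((1 / (4 * Real.cosh K ^ 2) * (2 * Real.sinh (2 * K)) ^ (m + 1) *
        Gf (m + 1) (Real.cosh (2 * K)) (Real.sinh (2 * K)) (Real.cos (qq N j)) (g j) : ℝ) : ℂ),
       ((1 / (4 * Real.cosh K ^ 2) * (2 * Real.sinh (2 * K)) ^ (m + 1) * (2 * Real.cosh K ^ 2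
        * Real.sin (qq N j) * (Real.sinh ((m + 1 : ℕ) * g j) / Real.sinh (g j))) : ℝ) : ℂ))) := by
  have hs : 0 < Real.sinh (2 * K) := Real.sinh_pos_iff.mpr (by linarith)
  have hsK : 0 < Real.sinh K := Real.sinh_pos_iff.mpr hK
  have hc := Real.cosh_pos K
  have i1 : Real.sinh (2 * K) = 2 * Real.sinh K * Real.cosh K := Real.sinh_two_mul K
  have i2 : Real.cosh (2 * K) = Real.cosh K ^ 2 + Real.sinh K ^ 2 := Real.cosh_two_mul K
  have i3 := Real.cosh_sq K
  have hS : ∀ j < N, Real.sinh (g j) ≠ 0 := fun j hj => by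
    rw [Ne, Real.sinh_eq_zero]; exact hg0 j hj
  induction m with
  | zero =>
    rw [Phi_zero, ← Psi_one, V1_Psi]
    congr 1
    funext j
    have hSj := hS j j.isLt
    have hgj := hg j j.isLt
    ext
    · simp only [mul_one, mul_zero, add_zero]
      norm_cast
      simp only [Gf, Nat.cast_add, Nat.cast_zero, zero_add, Nat.cast_one, one_mul, pow_one,
        div_self hSj, hgj, mul_one]
      rw [i2, i1]
      field_simp
      simp only [i3]; ring
    · simp only [mul_one, mul_zero, add_zero]
      norm_cast
      simp only [Nat.cast_add, Nat.cast_zero, zero_add, Nat.cast_one, one_mul, pow_one,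
        div_self hSj, mul_one]
      field_simp; ring
  | succ m ih =>
    rw [Phi_succ, ih, V2_Psi, V1_Psi]
    congr 1
    funext j
    have hSj := hS j j.isLt
    have hgj := hg j j.isLt
    have hS2 : Real.sinh (g j) ^ 2 = Real.cosh (g j) ^ 2 - 1 := by
      rw [Real.cosh_sq]; ring
    have hsc := Real.sin_sq_add_cos_sq (qq N j)
    have t1 : Real.cosh ((m + 1 + 1 : ℕ) * g j) = Real.cosh ((m + 1 : ℕ) * g j) *
        Real.cosh (g j) + Real.sinh (g j) ^ 2 * (Real.sinh ((m + 1 : ℕ) * g j) / Real.sinh (g j)) := by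
      rw [show ((m + 1 + 1 : ℕ) : ℝ) * g j = (m + 1 : ℕ) * g j + g j by push_cast; ring,
        Real.cosh_add]
      field_simp
    have t2 : Real.sinh ((m + 1 + 1 : ℕ) * g j) / Real.sinh (g j) =
        Real.cosh ((m + 1 : ℕ) * g j) +
        Real.cosh (g j) * (Real.sinh ((m + 1 : ℕ) * g j) / Real.sinh (g j)) := by
      rw [show ((m + 1 + 1 : ℕ) : ℝ) * g j = (m + 1 : ℕ) * g j + g j by push_cast; ring,
        Real.sinh_add]
      field_simp; ring
    ext
    · simp only
      norm_cast
      simp only [Gf]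
      rw [t1, t2, hS2, hgj]
      generalize Real.sinh ((m + 1 : ℕ) * g j) / Real.sinh (g j) = B
      generalize Real.cosh ((m + 1 : ℕ) * g j) = A
      rw [pow_succ (2 * Real.sinh (2 * K)) (m + 1)]
      generalize (2 * Real.sinh (2 * K)) ^ (m + 1) = X
      generalize Real.cos (qq N j) = c at *
      generalize Real.sin (qq N j) = sn at *
      rw [i2, i1]
      have hsn : sn ^ 2 = 1 - c ^ 2 := by linarith
      generalize Real.sinh K = a at *
      generalize Real.cosh K = b at *
      field_simp
      have b3 : b ^ 3 = b * (a ^ 2 + 1) := by rw [← i3]; ring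
      have b4 : b ^ 4 = (a ^ 2 + 1) ^ 2 := by rw [← i3]; ring
      have b5 : b ^ 5 = b * (a ^ 2 + 1) ^ 2 := by rw [← i3]; ring
      have b6 : b ^ 6 = (a ^ 2 + 1) ^ 3 := by rw [← i3]; ring
      have b7 : b ^ 7 = b * (a ^ 2 + 1) ^ 3 := by rw [← i3]; ring
      rw [← sub_eq_zero]
      ring_nf
      simp only [i3, b3, b4, b5, b6, b7, hsn]
      ring
    · simp only
      norm_cast
      simp only [Gf]
      rw [t2, hgj]
      generalize Real.sinh ((m + 1 : ℕ) * g j) / Real.sinh (g j) = B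
      generalize Real.cosh ((m + 1 : ℕ) * g j) = A
      rw [pow_succ (2 * Real.sinh (2 * K)) (m + 1)]
      generalize (2 * Real.sinh (2 * K)) ^ (m + 1) = X
      generalize Real.cos (qq N j) = c at *
      generalize Real.sin (qq N j) = sn at *
      rw [i2, i1]
      have hsn : sn ^ 2 = 1 - c ^ 2 := by linarith
      generalize Real.sinh K = a at *
      generalize Real.cosh K = b at *
      field_simp
      have b3 : b ^ 3 = b * (a ^ 2 + 1) := by rw [← i3]; ring
      have b4 : b ^ 4 = (a ^ 2 + 1) ^ 2 := by rw [← i3]; ring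
      have b5 : b ^ 5 = b * (a ^ 2 + 1) ^ 2 := by rw [← i3]; ring
      have b6 : b ^ 6 = (a ^ 2 + 1) ^ 3 := by rw [← i3]; ring
      have b7 : b ^ 7 = b * (a ^ 2 + 1) ^ 3 := by rw [← i3]; ring
      rw [← sub_eq_zero]
      ring_nf
      simp only [i3, b3, b4, b5, b6, b7, hsn]
      ring

theorem Zpart_exact (M N : ℕ) (hM : 0 < M) (K : ℝ) (hK : 0 < K) (g : ℕ → ℝ)
    (hg : ∀ j < N, Real.cosh (g j) = Real.sinh (2 * K) + 1 / Real.sinh (2 * K)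
      - Real.cos (qq N j)) (hg0 : ∀ j < N, g j ≠ 0) :
    Zpart M N K = (2 * Real.sinh (2 * K)) ^ (2 * M * N) / Real.cosh K ^ (2 * N) *
      ∏ j ∈ Finset.range N, Gf (2 * M) (Real.cosh (2 * K)) (Real.sinh (2 * K))
        (Real.cos (qq N j)) (g j) := by
  obtain ⟨m, hm⟩ : ∃ m, 2 * M = m + 1 := ⟨2 * M - 1, by omega⟩
  have h := Zpart_ev M N m hm K
  have hc := Real.cosh_pos K
  rw [Phi_Psi N K hK g m hg hg0, ev_Psi] at h
  simp only at h
  norm_cast at h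
  rw [h, hm, Finset.prod_mul_distrib, Fin.prod_univ_eq_prod_range (fun j => Gf (m + 1)
    (Real.cosh (2 * K)) (Real.sinh (2 * K)) (Real.cos (qq N j)) (g j)) N]
  rw [← mul_assoc]; congr 1
  rw [Finset.prod_const, Finset.card_univ, Fintype.card_fin, pow_mul (2 * Real.sinh (2 * K)),
    pow_mul (Real.cosh K), mul_pow, one_div, inv_pow, mul_pow, pow_mul 2 2 N]
  field_simp
  norm_num

end CI

namespace CI

lemma sinh_cosh_bounds (x : ℝ) (hx0 : 0 ≤ x) (hx : x ≤ 1) :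
    |Real.sinh x - x| ≤ x ^ 2 ∧ |Real.cosh x - 1| ≤ x ^ 2 := by
  have h1 := Real.abs_exp_sub_one_sub_id_le (x := x) (by rw [abs_of_nonneg hx0]; exact hx)
  have h2 := Real.abs_exp_sub_one_sub_id_le (x := -x) (by rw [abs_neg, abs_of_nonneg hx0]; exact hx)
  rw [abs_le] at h1 h2
  rw [Real.sinh_eq, Real.cosh_eq, abs_le, abs_le]
  refine ⟨⟨?_, ?_⟩, ?_, ?_⟩ <;> nlinarith

lemma exp_two_betac : Real.exp (2 * betac) = 1 + Real.sqrt 2 := by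
  unfold betac
  rw [mul_div_cancel₀ _ (two_ne_zero), Real.exp_log (by positivity)]

lemma exp_neg_two_betac : Real.exp (-(2 * betac)) = Real.sqrt 2 - 1 := by
  rw [Real.exp_neg, exp_two_betac, inv_eq_iff_eq_inv, ← one_div, eq_div_iff]
  · have := Real.mul_self_sqrt (show (0 : ℝ) ≤ 2 by norm_num)
    linarith
  · have : (1 : ℝ) < Real.sqrt 2 := by
      rw [Real.lt_sqrt] <;> norm_num
    linarith

lemma sinh_two_betac : Real.sinh (2 * betac) = 1 := by
  rw [Real.sinh_eq, exp_two_betac, exp_neg_two_betac]; ring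

lemma cosh_two_betac : Real.cosh (2 * betac) = Real.sqrt 2 := by
  rw [Real.cosh_eq, exp_two_betac, exp_neg_two_betac]; ring

lemma sqrt2_bounds : (1.4 : ℝ) ≤ Real.sqrt 2 ∧ Real.sqrt 2 ≤ 1.5 := by
  constructor
  · apply Real.le_sqrt_of_sq_le; norm_num
  · rw [Real.sqrt_le_left] <;> norm_num

lemma betac_gt : (1 / 10 : ℝ) < betac := by
  have h : Real.log (Real.exp (1 / 5)) < Real.log (1 + Real.sqrt 2) := by
    apply Real.log_lt_log (Real.exp_pos _)
    have h1 := Real.abs_exp_sub_one_sub_id_le (x := 1 / 5) (by rw [abs_of_nonneg] <;> norm_num)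
    rw [abs_le] at h1
    have := sqrt2_bounds.1
    norm_num at *
    linarith
  rw [Real.log_exp] at h
  unfold betac; linarith

set_option maxHeartbeats 1000000 in
/-- small parameter estimates -/
lemma params (u : ℝ) (hu0 : 0 ≤ u) (hu : u ≤ 1 / 100) (s C : ℝ)
    (hs : s = Real.sinh (2 * (betac - u))) (hC : C = Real.cosh (2 * (betac - u))) :
    0 < s ∧ s ≤ 1 ∧ |Real.log s + 2 * Real.sqrt 2 * u| ≤ 100 * u ^ 2 ∧
    0 ≤ 1 / s - 1 ∧ 1 / s - 1 ≤ 4 * u ∧ |Real.sqrt 2 * (1 / s - 1) - 4 * u| ≤ 100 * u ^ 2 ∧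
    0 ≤ s + 1 / s - 2 ∧ s + 1 / s - 2 ≤ 16 * u ^ 2 ∧ |s + 1 / s - 2 - 8 * u ^ 2| ≤ 1000 * u ^ 3 ∧
    |C - Real.sqrt 2| ≤ 20 * u ∧ 0 < C := by
  have hC0 : 0 < C := hC ▸ Real.cosh_pos _
  rw [show 2 * (betac - u) = 2 * betac - 2 * u by ring] at hs hC
  rw [Real.sinh_sub, sinh_two_betac, cosh_two_betac] at hs
  rw [Real.cosh_sub, sinh_two_betac, cosh_two_betac] at hC
  obtain ⟨h1, h2⟩ := sinh_cosh_bounds (2 * u) (by linarith) (by linarith)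
  have r := Real.mul_self_sqrt (show (0 : ℝ) ≤ 2 by norm_num)
  obtain ⟨r1, r2⟩ := sqrt2_bounds
  generalize Real.sqrt 2 = q at *
  generalize Real.sinh (2 * u) = sh at *
  generalize Real.cosh (2 * u) = ch at *
  rw [abs_le] at h1 h2
  have hu2 : u ^ 2 ≤ u / 100 := by nlinarith
  have hu2' : 0 ≤ u ^ 2 := by positivity
  have b1 : |1 - s - 2 * q * u| ≤ 10 * u ^ 2 := by
    rw [abs_le]; subst hs; constructor <;> nlinarith
  rw [abs_le] at b1
  set d := 1 - s with hd
  have hd0 : 0 ≤ d := by nlinarith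
  have hd1 : d ≤ 3.2 * u := by nlinarith
  have hsd : s = 1 - d := by linarith
  have hs0 : 0.96 ≤ s := by linarith
  have hsp : 0 < s := by linarith
  set e := 1 / s - 1 with he
  have hes : e * s = d := by rw [he]; field_simp; linarith
  have he0 : 0 ≤ e := by
    rw [he, sub_nonneg, le_div_iff₀ hsp]; linarith
  have hed : e - d = e * d := by rw [hsd] at hes; linarith
  have he1 : e ≤ 4 * u := by nlinarith
  have hed2 : e * d ≤ 13 * u ^ 2 := by nlinarith
  have ha : s + 1 / s - 2 = e * d := by rw [← hed, he, hd]; ring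
  have hed0 : 0 ≤ e * d := mul_nonneg he0 hd0
  refine ⟨hsp, by linarith, ?_, he0, he1, ?_, ?_, ?_, ?_, ?_, hC0⟩
  · have l1 := Real.log_le_sub_one_of_pos hsp
    have l2 := Real.one_sub_inv_le_log_of_pos hsp
    rw [← one_div] at l2
    have l2' : -e ≤ Real.log s := by rw [he]; linarith
    rw [abs_le]; constructor <;> linarith
  · have : q * e - 4 * u = q * (d - 2 * q * u) + q * (e * d) := by
      rw [← hed]; linear_combination (2 * u) * r
    have k1 : |q * (d - 2 * q * u)| ≤ 1.5 * (10 * u ^ 2) := by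
      rw [abs_mul, abs_of_nonneg (by linarith : 0 ≤ q)]
      exact mul_le_mul r2 (abs_le.mpr b1) (abs_nonneg _) (by norm_num)
    have k2 : |q * (e * d)| ≤ 1.5 * (13 * u ^ 2) := by
      rw [abs_mul, abs_of_nonneg (by linarith : 0 ≤ q), abs_of_nonneg hed0]
      exact mul_le_mul r2 hed2 hed0 (by norm_num)
    rw [this]
    refine (abs_add_le _ _).trans ?_
    linarith
  · rw [ha]; exact hed0
  · rw [ha]; linarith
  · rw [ha]
    have key : e * d - 8 * u ^ 2 = (d - 2 * q * u) * (d + 2 * q * u) + d * (e * d) := by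
      linear_combination (4 * u ^ 2) * r + d * hed
    have k1 : |(d - 2 * q * u) * (d + 2 * q * u)| ≤ 10 * u ^ 2 * (7 * u) := by
      rw [abs_mul]
      refine mul_le_mul (abs_le.mpr b1) ?_ (abs_nonneg _) (by positivity)
      rw [abs_of_nonneg (by positivity)]; nlinarith
    have k2 : |d * (e * d)| ≤ (3.2 * u) * (13 * u ^ 2) := by
      rw [abs_of_nonneg (by positivity)]
      exact mul_le_mul hd1 hed2 hed0 (by positivity)
    rw [key]
    refine (abs_add_le _ _).trans ?_
    have : 0 ≤ u ^ 3 := by positivity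
    nlinarith
  · subst hC
    rw [abs_le]; constructor <;> nlinarith

lemma log_cosh_bound (u : ℝ) (hu0 : 0 ≤ u) (hu : u ≤ 1 / 100) :
    |Real.log (Real.cosh betac) - Real.log (Real.cosh (betac - u))| ≤ u := by
  have hb := betac_gt
  have h1 : Real.cosh (betac - u) ≤ Real.cosh betac := by
    rw [Real.cosh_le_cosh, abs_of_pos (by linarith), abs_of_pos (by linarith)]; linarith
  have h2 : Real.cosh betac ≤ Real.exp u * Real.cosh (betac - u) := by
    have : Real.exp (-betac) ≤ Real.exp (u + -(betac - u)) := Real.exp_le_exp.mpr (by linarith)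
    have e2 : Real.exp (u + (betac - u)) = Real.exp betac := by ring_nf
    rw [Real.cosh_eq, Real.cosh_eq, mul_div_assoc', mul_add, ← Real.exp_add, ← Real.exp_add, e2]
    linarith
  have p1 := Real.cosh_pos (betac - u)
  have p2 := Real.cosh_pos betac
  have l1 := Real.log_le_log p1 h1
  have l2 := Real.log_le_log p2 h2
  rw [Real.log_mul (Real.exp_pos _).ne' p1.ne', Real.log_exp] at l2
  rw [abs_le]; constructor <;> linarith

end CI

namespace CI

lemma cosh_slope (x y : ℝ) (h : x ≤ y) :
    Real.sinh x * (y - x) ≤ Real.cosh y - Real.cosh x ∧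
    Real.cosh y - Real.cosh x ≤ Real.sinh y * (y - x) := by
  rcases h.eq_or_lt with rfl | h
  · simp
  obtain ⟨z, hz, hz2⟩ := exists_deriv_eq_slope Real.cosh h Real.continuous_cosh.continuousOn
    Real.differentiable_cosh.differentiableOn
  rw [Real.deriv_cosh, eq_div_iff (by linarith)] at hz2
  have h1 : Real.sinh x ≤ Real.sinh z := Real.sinh_le_sinh.mpr hz.1.le
  have h2 : Real.sinh z ≤ Real.sinh y := Real.sinh_le_sinh.mpr hz.2.le
  rw [← hz2]
  constructor
  · exact mul_le_mul_of_nonneg_right h1 (by linarith)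
  · exact mul_le_mul_of_nonneg_right h2 (by linarith)

/-- log of the factor -/
lemma log_Gf (m : ℕ) (C s c g : ℝ) (hg : 0 < g) (hD : 0 ≤ C * (1 / s - c)) :
    Real.log (Gf m C s c g) = m * g - Real.log 2 + Real.log (1 + Real.exp (-(2 * m * g)) +
      C * (1 / s - c) / Real.sinh g * (1 - Real.exp (-(2 * m * g)))) ∧ 0 < Gf m C s c g := by
  have hS : 0 < Real.sinh g := Real.sinh_pos_iff.mpr hg
  set F := C * (1 / s - c) / Real.sinh g with hF
  have hF0 : 0 ≤ F := by positivity
  set y := Real.exp (-(2 * m * g)) with hy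
  have hy1 : y ≤ 1 := by
    rw [hy, Real.exp_le_one_iff]
    have : 0 ≤ 2 * m * g := by positivity
    linarith
  have hy0 : 0 < y := Real.exp_pos _
  have hp : 0 < 1 + y + F * (1 - y) := by
    have : 0 ≤ F * (1 - y) := mul_nonneg hF0 (by linarith)
    linarith
  have e1 : Real.exp (m * g) * y = Real.exp (-(m * g)) := by
    rw [hy, ← Real.exp_add]; ring_nf
  have key : Gf m C s c g = Real.exp (m * g) / 2 * (1 + y + F * (1 - y)) := by
    unfold Gf
    rw [Real.cosh_eq, Real.sinh_eq (m * g), ← e1, hF]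
    field_simp
  have hp2 : 0 < Real.exp (m * g) / 2 := by positivity
  constructor
  · rw [key, Real.log_mul hp2.ne' hp.ne', Real.log_div (Real.exp_pos _).ne' two_ne_zero,
      Real.log_exp]
  · rw [key]; positivity

lemma log_diff (H H0 : ℝ) (h : 1 ≤ H) (h0 : 1 ≤ H0) :
    |Real.log H - Real.log H0 - (H - H0)| ≤ (H - H0) ^ 2 + |H - H0| * (H0 - 1) := by
  have p : 0 < H := by linarith
  have p0 : 0 < H0 := by linarith
  have u1 : Real.log H - Real.log H0 ≤ (H - H0) / H0 := by
    rw [← Real.log_div p.ne' p0.ne']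
    refine (Real.log_le_sub_one_of_pos (by positivity)).trans (le_of_eq ?_)
    field_simp
  have u2 : (H - H0) / H ≤ Real.log H - Real.log H0 := by
    rw [← Real.log_div p.ne' p0.ne']
    refine (le_of_eq ?_).trans (Real.one_sub_inv_le_log_of_pos (by positivity))
    field_simp
  have e1 : (H - H0) / H0 - (H - H0) / H = (H - H0) ^ 2 / (H * H0) := by field_simp
  have e2 : (H - H0) ^ 2 / (H * H0) ≤ (H - H0) ^ 2 :=
    div_le_self (sq_nonneg _) (by nlinarith)
  have e3 : |(H - H0) / H0 - (H - H0)| ≤ |H - H0| * (H0 - 1) := by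
    have : (H - H0) / H0 - (H - H0) = -((H - H0) * ((H0 - 1) / H0)) := by field_simp; ring
    rw [this, abs_neg, abs_mul]
    refine mul_le_mul_of_nonneg_left ?_ (abs_nonneg _)
    rw [abs_of_nonneg (div_nonneg (by linarith) p0.le)]
    exact div_le_self (by linarith) h0
  rw [abs_le] at e3 ⊢
  constructor <;> linarith

lemma gamma0_bounds (σ g : ℝ) (h0 : 0 < σ) (h1 : σ ≤ 1) (hg : 0 < g)
    (hc : Real.cosh g = 1 + 2 * σ ^ 2) :
    2 * σ ≤ Real.sinh g ∧ Real.sinh g ≤ 2 * σ * (1 + σ ^ 2) ∧ Real.sinh g ≤ 3 * σ ∧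
      2 * σ / 3 ≤ g := by
  have hS : 0 < Real.sinh g := Real.sinh_pos_iff.mpr hg
  have h2 : Real.sinh g ^ 2 = 4 * σ ^ 2 + 4 * σ ^ 4 := by
    rw [Real.sinh_sq, hc]; ring
  have hσ2 : σ ^ 2 ≤ 1 := by nlinarith
  have a1 : 2 * σ ≤ Real.sinh g := by
    apply le_of_sq_le_sq _ hS.le
    rw [h2]; nlinarith [sq_nonneg (σ ^ 2)]
  have a2 : Real.sinh g ≤ 2 * σ * (1 + σ ^ 2) := by
    apply le_of_sq_le_sq _ (by positivity)
    rw [h2]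
    have : 0 ≤ σ ^ 4 := by positivity
    have : 0 ≤ σ ^ 6 := by positivity
    nlinarith
  have a3 : Real.sinh g ≤ 3 * σ := by
    apply le_of_sq_le_sq _ (by positivity)
    rw [h2]
    nlinarith [mul_le_mul_of_nonneg_left hσ2 (sq_nonneg σ)]
  refine ⟨a1, a2, a3, ?_⟩
  have := (cosh_slope 0 g hg.le).2
  rw [Real.cosh_zero, hc] at this
  have h4 : 2 * σ ^ 2 ≤ 3 * σ * g := by nlinarith
  have : 2 * σ ≤ 3 * g := by
    by_contra hh
    push Not at hh
    nlinarith
  linarith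

end CI

namespace CI

lemma mode_F (u σ C e a S S0 : ℝ) (hu0 : 0 ≤ u) (hσ : 0 < σ) (hσ1 : σ ≤ 1) (huσ : u ≤ σ)
    (he0 : 0 ≤ e) (he1 : e ≤ 4 * u) (ha0 : 0 ≤ a) (ha1 : a ≤ 16 * u ^ 2)
    (hC : |C - Real.sqrt 2| ≤ 20 * u) (hSS : S0 ≤ S) (hS0 : 2 * σ ≤ S0)
    (hS2 : S ^ 2 - S0 ^ 2 = a * (2 + 4 * σ ^ 2 + a)) :
    0 ≤ 1 / S0 - 1 / S ∧ 1 / S0 - 1 / S ≤ 22 * u ^ 2 / σ ^ 3 ∧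
    |C * (e + 2 * σ ^ 2) / S - Real.sqrt 2 * (2 * σ ^ 2) / S0 - Real.sqrt 2 * e / S0| ≤
      20 * u + 238 * (u / σ) ^ 2 := by
  obtain ⟨q1, q2⟩ := sqrt2_bounds
  have p0 : 0 < S0 := by linarith
  have p : 0 < S := by linarith
  have hr0 : 0 ≤ u / σ := by positivity
  have hr1 : u / σ ≤ 1 := by rw [div_le_one hσ]; exact huσ
  have hur : u = u / σ * σ := by field_simp
  have hu1 : u ≤ 1 := huσ.trans hσ1
  have d0 : 0 ≤ 1 / S0 - 1 / S := by
    rw [sub_nonneg]; exact one_div_le_one_div_of_le p0 hSS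
  have hσ2 : σ ^ 2 ≤ 1 := by nlinarith
  have ha16 : a ≤ 16 := by nlinarith
  have d1 : 1 / S0 - 1 / S ≤ 22 * u ^ 2 / σ ^ 3 := by
    have e1 : 1 / S0 - 1 / S = (a * (2 + 4 * σ ^ 2 + a)) / (S0 * S * (S + S0)) := by
      rw [← hS2]; field_simp; ring
    rw [e1]
    have n1 : a * (2 + 4 * σ ^ 2 + a) ≤ 16 * u ^ 2 * 22 := by
      apply mul_le_mul ha1 (by linarith) (by positivity) (by positivity)
    have n2 : 16 * σ ^ 3 ≤ S0 * S * (S + S0) := by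
      have : (2 * σ) * (2 * σ) * (2 * σ + 2 * σ) ≤ S0 * S * (S + S0) := by
        have : 2 * σ ≤ S := by linarith
        gcongr
      linarith
    calc _ ≤ 16 * u ^ 2 * 22 / (16 * σ ^ 3) := by gcongr
      _ = _ := by field_simp
  refine ⟨d0, d1, ?_⟩
  generalize Real.sqrt 2 = q at *
  have key : C * (e + 2 * σ ^ 2) / S - q * (2 * σ ^ 2) / S0 - q * e / S0 =
      (C - q) * ((e + 2 * σ ^ 2) / S) - q * (e + 2 * σ ^ 2) * (1 / S0 - 1 / S) := by
    field_simp; ring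
  have n : 0 ≤ e + 2 * σ ^ 2 := by positivity
  have n2 : e + 2 * σ ^ 2 ≤ 4 * u + 2 * σ ^ 2 := by linarith
  have t1 : |(C - q) * ((e + 2 * σ ^ 2) / S)| ≤ 20 * u * ((4 * u + 2 * σ ^ 2) / (2 * σ)) := by
    rw [abs_mul]
    refine mul_le_mul hC ?_ (abs_nonneg _) (by positivity)
    rw [abs_of_nonneg (by positivity)]
    have : 2 * σ ≤ S := by linarith
    gcongr
  have t2 : |q * (e + 2 * σ ^ 2) * (1 / S0 - 1 / S)| ≤
      1.5 * (4 * u + 2 * σ ^ 2) * (22 * u ^ 2 / σ ^ 3) := by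
    rw [abs_of_nonneg (mul_nonneg (mul_nonneg (by linarith) n) d0)]
    gcongr
  rw [key]
  refine (abs_sub _ _).trans ((add_le_add t1 t2).trans ?_)
  generalize u / σ = r at *
  subst hur
  have e1 : 20 * (r * σ) * ((4 * (r * σ) + 2 * σ ^ 2) / (2 * σ)) = 40 * r ^ 2 * σ + 20 * (r * σ) * σ := by
    field_simp; ring
  have e2 : 1.5 * (4 * (r * σ) + 2 * σ ^ 2) * (22 * (r * σ) ^ 2 / σ ^ 3) =
      132 * r ^ 3 + 66 * r ^ 2 * σ := by
    field_simp; ring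
  rw [e1, e2]
  have i1 : r ^ 2 * σ ≤ r ^ 2 := mul_le_of_le_one_right (by positivity) hσ1
  have i2 : r * σ * σ ≤ r * σ := mul_le_of_le_one_right (by positivity) hσ1
  have i3 : r ^ 3 ≤ r ^ 2 := pow_le_pow_of_le_one hr0 hr1 (by norm_num)
  linarith

set_option maxHeartbeats 2000000 in
/-- per-mode expansion -/
lemma mode (m : ℕ) (hm : 0 < m) (u σ C s c g g0 : ℝ) (hu0 : 0 ≤ u) (hσ : 0 < σ) (hσ1 : σ ≤ 1)
    (huσ : u ≤ σ) (hc : c = 1 - 2 * σ ^ 2)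
    (he0 : 0 ≤ 1 / s - 1) (he1 : 1 / s - 1 ≤ 4 * u) (ha0 : 0 ≤ s + 1 / s - 2)
    (ha1 : s + 1 / s - 2 ≤ 16 * u ^ 2)
    (hC : |C - Real.sqrt 2| ≤ 20 * u) (hC0 : 0 < C) (hg : 0 < g) (hg0 : 0 < g0)
    (hcg : Real.cosh g = s + 1 / s - c) (hcg0 : Real.cosh g0 = 2 - c) :
    |Real.log (Gf m C s c g) - Real.log (Gf m (Real.sqrt 2) 1 c g0) -
      (m * (s + 1 / s - 2) + Real.sqrt 2 * (1 / s - 1)) / Real.sinh g0| ≤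
    100000 * (u + u ^ 2 / σ ^ 2 + m * u ^ 4 / σ ^ 3 + u * (Real.exp (-(2 * m * g0)) / σ)) := by
  obtain ⟨q1, q2⟩ := sqrt2_bounds
  have hcc : 1 / s - c = (1 / s - 1) + 2 * σ ^ 2 := by rw [hc]; ring
  rw [(log_Gf m C s c g hg (by rw [hcc]; positivity)).1,
    (log_Gf m (Real.sqrt 2) 1 c g0 hg0 (by rw [hc, show (1 / 1 - (1 - 2 * σ ^ 2) : ℝ) = 2 * σ ^ 2 by ring]; positivity)).1]
  rw [hcc, show (1 / 1 - c : ℝ) = 2 * σ ^ 2 by rw [hc]; ring]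
  have hcg' : Real.cosh g = 1 + 2 * σ ^ 2 + (s + 1 / s - 2) := by rw [hcg, hc]; ring
  have hcg0' : Real.cosh g0 = 1 + 2 * σ ^ 2 := by rw [hcg0, hc]; ring
  generalize 1 / s - 1 = e at *
  generalize s + 1 / s - 2 = a at *
  obtain ⟨b1, -, b3, b4⟩ := gamma0_bounds σ g0 hσ hσ1 hg0 hcg0'
  have hgg : g0 ≤ g := by
    have : Real.cosh g0 ≤ Real.cosh g := by rw [hcg', hcg0']; linarith
    rwa [Real.cosh_le_cosh, abs_of_pos hg, abs_of_pos hg0] at this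
  have hSS : Real.sinh g0 ≤ Real.sinh g := Real.sinh_le_sinh.mpr hgg
  have hS2 : Real.sinh g ^ 2 - Real.sinh g0 ^ 2 = a * (2 + 4 * σ ^ 2 + a) := by
    rw [Real.sinh_sq, Real.sinh_sq, hcg', hcg0']; ring
  obtain ⟨d0, d1, f1⟩ := mode_F u σ C e a (Real.sinh g) (Real.sinh g0) hu0 hσ hσ1 huσ he0 he1 ha0
    ha1 hC hSS b1 hS2
  obtain ⟨sl1, sl2⟩ := cosh_slope g0 g hgg
  rw [show Real.cosh g - Real.cosh g0 = a by rw [hcg', hcg0']; ring] at sl1 sl2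
  set S0 := Real.sinh g0 with hS0def
  set S := Real.sinh g with hSdef
  have p0 : 0 < S0 := by linarith
  have p : 0 < S := by linarith
  have hmR : (0 : ℝ) < m := by exact_mod_cast hm
  have hr0 : 0 ≤ u / σ := by positivity
  have hr1 : u / σ ≤ 1 := by rw [div_le_one hσ]; exact huσ
  have hur : u = u / σ * σ := by field_simp
  -- gamma part
  have g1 : g - g0 ≤ a / S0 := by rw [le_div_iff₀ p0]; linarith
  have g2 : a / S ≤ g - g0 := by rw [div_le_iff₀ p]; linarith
  have g3 : |m * g - m * g0 - m * a / S0| ≤ 352 * (m * u ^ 4 / σ ^ 3) := by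
    have : a / S0 - a / S ≤ 16 * u ^ 2 * (22 * u ^ 2 / σ ^ 3) := by
      rw [show a / S0 - a / S = a * (1 / S0 - 1 / S) by ring]
      exact mul_le_mul ha1 d1 d0 (by positivity)
    have h2 : |g - g0 - a / S0| ≤ 16 * u ^ 2 * (22 * u ^ 2 / σ ^ 3) := by
      rw [abs_le]; constructor <;> linarith [show 0 ≤ 16 * u ^ 2 * (22 * u ^ 2 / σ ^ 3) by positivity]
    rw [show m * g - m * g0 - m * a / S0 = m * (g - g0 - a / S0) by ring, abs_mul,
      abs_of_pos hmR]
    refine (mul_le_mul_of_nonneg_left h2 hmR.le).trans (le_of_eq ?_)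
    ring
  -- y part
  set y0 := Real.exp (-(2 * m * g0)) with hy0
  set y := Real.exp (-(2 * m * g)) with hy
  have y0p : 0 < y0 := Real.exp_pos _
  have yp : 0 < y := Real.exp_pos _
  have yy : y ≤ y0 := by
    rw [hy, hy0, Real.exp_le_exp]
    have : 2 * m * g0 ≤ 2 * m * g := by gcongr
    linarith
  have y01 : y0 ≤ 1 := by
    rw [hy0, Real.exp_le_one_iff]
    have : 0 ≤ 2 * m * g0 := by positivity
    linarith
  have y02 : y0 * (2 * m * g0) ≤ 1 := by
    have := Real.add_one_le_exp (2 * m * g0)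
    rw [hy0, Real.exp_neg, inv_mul_le_iff₀ (Real.exp_pos _)]
    linarith
  have yd : y0 - y ≤ 12 * (u / σ) ^ 2 := by
    have e1 : y = y0 * Real.exp (-(2 * m * (g - g0))) := by
      rw [hy, hy0, ← Real.exp_add]; ring_nf
    have e2 := Real.add_one_le_exp (-(2 * m * (g - g0)))
    have e3 : y0 - y ≤ y0 * (2 * m * (g - g0)) := by
      rw [e1]; nlinarith
    have e4 : y0 * (2 * m * (g - g0)) ≤ (y0 * (2 * m * g0)) * (a / S0 / g0) := by
      rw [show (y0 * (2 * m * g0)) * (a / S0 / g0) = y0 * (2 * m * (a / S0)) by field_simp]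
      gcongr
    have e5 : (y0 * (2 * m * g0)) * (a / S0 / g0) ≤ 1 * (16 * u ^ 2 / (2 * σ) / (2 * σ / 3)) := by
      gcongr
    refine e3.trans (e4.trans (e5.trans (le_of_eq ?_)))
    field_simp; ring
  -- F part
  set F := C * (e + 2 * σ ^ 2) / S with hF
  set F0 := Real.sqrt 2 * (2 * σ ^ 2) / S0 with hF0
  have F0n : 0 ≤ F0 := by positivity
  have Fn : 0 ≤ F := by positivity
  have F0u : F0 ≤ 1.5 * σ := by
    rw [hF0, div_le_iff₀ p0]
    calc Real.sqrt 2 * (2 * σ ^ 2) ≤ 1.5 * (2 * σ ^ 2) := by gcongr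
      _ = 1.5 * σ * (2 * σ) := by ring
      _ ≤ _ := by gcongr
  have f2 : Real.sqrt 2 * e / S0 ≤ 3 * (u / σ) := by
    calc Real.sqrt 2 * e / S0 ≤ 1.5 * (4 * u) / (2 * σ) := by gcongr
      _ = _ := by field_simp; ring
  have f20 : 0 ≤ Real.sqrt 2 * e / S0 := by positivity
  have hur' : u ≤ u / σ := by rw [le_div_iff₀ hσ]; exact mul_le_of_le_one_right hu0 hσ1
  have hr2 : (u / σ) ^ 2 ≤ u / σ := by nlinarith
  have f3 : |F - F0| ≤ 261 * (u / σ) := by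
    rw [abs_le] at f1 ⊢
    constructor <;> linarith
  set H := 1 + y + F * (1 - y) with hH
  set H0 := 1 + y0 + F0 * (1 - y0) with hH0
  have H1 : 1 ≤ H := by
    have : 0 ≤ F * (1 - y) := mul_nonneg Fn (by linarith)
    linarith
  have H01 : 1 ≤ H0 := by
    have : 0 ≤ F0 * (1 - y0) := mul_nonneg F0n (by linarith)
    linarith
  have H02 : H0 - 1 ≤ y0 + 1.5 * σ := by
    have : F0 * (1 - y0) ≤ F0 := mul_le_of_le_one_right F0n (by linarith)
    linarith
  have hd : H - H0 - (F - F0) = -((F - F0) * y) + (y - y0) * (1 - F0) := by rw [hH, hH0]; ring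
  have v1 : |(y - y0) * (1 - F0)| ≤ 12 * (u / σ) ^ 2 := by
    rw [abs_mul, abs_sub_comm, abs_of_nonneg (by linarith : 0 ≤ y0 - y)]
    have : |1 - F0| ≤ 1 := by rw [abs_le]; constructor <;> linarith
    calc _ ≤ 12 * (u / σ) ^ 2 * 1 := mul_le_mul yd this (abs_nonneg _) (by positivity)
      _ = _ := by ring
  have v2 : |(F - F0) * y| ≤ 261 * (u / σ) * y0 := by
    rw [abs_mul, abs_of_pos yp]
    gcongr
  have hd2 : |H - H0 - (F - F0)| ≤ 261 * (u / σ) * y0 + 12 * (u / σ) ^ 2 := by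
    rw [hd]
    refine (abs_add_le _ _).trans ?_
    rw [abs_neg]; linarith
  have hd3 : |H - H0| ≤ 273 * (u / σ) := by
    have e1 : H - H0 = (F - F0) * (1 - y) + (y - y0) * (1 - F0) := by rw [hH, hH0]; ring
    have e2 : |(F - F0) * (1 - y)| ≤ 261 * (u / σ) * 1 := by
      rw [abs_mul]
      refine mul_le_mul f3 ?_ (abs_nonneg _) (by positivity)
      rw [abs_le]; constructor <;> linarith
    rw [e1]
    refine (abs_add_le _ _).trans ?_
    linarith
  have L := log_diff H H0 H1 H01
  have L1 : (H - H0) ^ 2 ≤ 74529 * (u / σ) ^ 2 := by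
    rw [← sq_abs]
    calc |H - H0| ^ 2 ≤ (273 * (u / σ)) ^ 2 := by gcongr
      _ = _ := by ring
  have L2 : |H - H0| * (H0 - 1) ≤ 273 * (u / σ) * (y0 + 1.5 * σ) :=
    mul_le_mul hd3 H02 (by linarith) (by positivity)
  have L2' : 273 * (u / σ) * (y0 + 1.5 * σ) = 273 * (u / σ * y0) + 409.5 * u := by
    field_simp
    ring
  rw [show u ^ 2 / σ ^ 2 = (u / σ) ^ 2 by ring, show u * (y0 / σ) = u / σ * y0 by ring]
  have n1 : 0 ≤ m * u ^ 4 / σ ^ 3 := by positivity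
  have n2 : 0 ≤ u / σ * y0 := by positivity
  have n3 : 0 ≤ (u / σ) ^ 2 := by positivity
  have split : m * g - Real.log 2 + Real.log H - (m * g0 - Real.log 2 + Real.log H0) -
      (m * a + Real.sqrt 2 * e) / S0 =
      (m * g - m * g0 - m * a / S0) + (Real.log H - Real.log H0 - (H - H0)) +
      (H - H0 - (F - F0)) + (F - F0 - Real.sqrt 2 * e / S0) := by ring
  rw [split]
  refine (abs_add_le _ _).trans ((add_le_add ((abs_add_le _ _).trans (add_le_add (abs_add_le _ _)
    le_rfl)) le_rfl).trans ?_)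
  linarith

/-- bound for the exponentially small factor -/
lemma y0_bound (m : ℕ) (hm : 0 < m) (σ g0 : ℝ) (hσ : 0 < σ) (hσ1 : σ ≤ 1) (hg0 : 0 < g0)
    (hcg0 : Real.cosh g0 = 1 + 2 * σ ^ 2) :
    Real.exp (-(2 * m * g0)) ≤ 1 ∧ Real.exp (-(2 * m * g0)) ≤ 1 / (m * σ) := by
  obtain ⟨b1, -, b3, b4⟩ := gamma0_bounds σ g0 hσ hσ1 hg0 hcg0
  have hmR : (0 : ℝ) < m := by exact_mod_cast hm
  constructor
  · rw [Real.exp_le_one_iff]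
    have : 0 ≤ 2 * m * g0 := by positivity
    linarith
  · have := Real.add_one_le_exp (2 * m * g0)
    rw [Real.exp_neg, ← one_div]
    apply one_div_le_one_div_of_le (by positivity)
    have : 2 * m * (2 * σ / 3) ≤ 2 * m * g0 := by gcongr
    have : 0 < m * σ := by positivity
    linarith

end CI

namespace CI

noncomputable def sig (N j : ℕ) : ℝ := Real.sin (qq N j / 2)

lemma qq_bounds (N j : ℕ) (h : j < N) : 0 < qq N j ∧ qq N j < Real.pi := by
  have hN : (0 : ℝ) < N := by exact_mod_cast (Nat.zero_le j).trans_lt h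
  have hj : (2 * j + 1 : ℝ) < 2 * N := by exact_mod_cast (by omega : 2 * j + 1 < 2 * N)
  have := Real.pi_pos
  unfold qq
  constructor
  · positivity
  · rw [div_lt_iff₀ (by positivity), mul_comm]
    exact mul_lt_mul_of_pos_left hj this

lemma sig_bounds (N j : ℕ) (h : j < N) : 0 < sig N j ∧ sig N j ≤ 1 ∧
    (2 * j + 1 : ℝ) / (2 * N) ≤ sig N j ∧ Real.cos (qq N j) = 1 - 2 * sig N j ^ 2 := by
  have hN : (0 : ℝ) < N := by exact_mod_cast (Nat.zero_le j).trans_lt h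
  obtain ⟨q0, q1⟩ := qq_bounds N j h
  have h1 := Real.mul_le_sin (x := qq N j / 2) (by linarith) (by linarith)
  have e : 2 / Real.pi * (qq N j / 2) = (2 * j + 1 : ℝ) / (2 * N) := by
    unfold qq; have := Real.pi_pos; field_simp
  rw [e] at h1
  refine ⟨lt_of_lt_of_le (by positivity) h1, Real.sin_le_one _, h1, ?_⟩
  have := Real.cos_sq_add_sin_sq (qq N j / 2)
  have h2 := Real.cos_two_mul (qq N j / 2)
  rw [mul_div_cancel₀ _ (two_ne_zero)] at h2
  rw [h2]; unfold sig; linarith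

lemma tele (J n : ℕ) (h : J ≤ n) :
    ∑ j ∈ Finset.Ico J n, 4 / (2 * (j : ℝ) + 1) ^ 2 ≤ 8 / ((J : ℝ) + 1) - 8 / ((n : ℝ) + 1) := by
  induction n, h using Nat.le_induction with
  | base => simp
  | succ n h ih =>
    rw [Finset.sum_Ico_succ_top h]
    have : 4 / (2 * (n : ℝ) + 1) ^ 2 ≤ 8 / ((n : ℝ) + 1) - 8 / (((n + 1 : ℕ) : ℝ) + 1) := by
      have hn : (0 : ℝ) ≤ n := Nat.cast_nonneg n
      push_cast
      rw [div_sub_div _ _ (by positivity) (by positivity), div_le_div_iff₀ (by positivity) (by positivity)]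
      nlinarith
    linarith

lemma inv_sig (N j : ℕ) (h : j < N) : 1 / sig N j ≤ N * (2 / (2 * (j : ℝ) + 1)) := by
  have hN : (0 : ℝ) < N := by exact_mod_cast (Nat.zero_le j).trans_lt h
  obtain ⟨-, -, h3, -⟩ := sig_bounds N j h
  refine (one_div_le_one_div_of_le (by positivity) h3).trans (le_of_eq ?_)
  field_simp

lemma inv_sig_sq (N j : ℕ) (h : j < N) : 1 / sig N j ^ 2 ≤ N ^ 2 * (4 / (2 * (j : ℝ) + 1) ^ 2) := by
  obtain ⟨h1, -, -, -⟩ := sig_bounds N j h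
  calc 1 / sig N j ^ 2 = (1 / sig N j) ^ 2 := by field_simp
    _ ≤ (N * (2 / (2 * (j : ℝ) + 1))) ^ 2 := by gcongr; exact inv_sig N j h
    _ = _ := by field_simp; norm_num

lemma sum_sig_sq (N : ℕ) : ∑ j ∈ Finset.range N, 1 / sig N j ^ 2 ≤ 8 * (N : ℝ) ^ 2 := by
  calc _ ≤ ∑ j ∈ Finset.range N, (N : ℝ) ^ 2 * (4 / (2 * (j : ℝ) + 1) ^ 2) :=
        Finset.sum_le_sum fun j hj => inv_sig_sq N j (Finset.mem_range.mp hj)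
    _ = (N : ℝ) ^ 2 * ∑ j ∈ Finset.Ico 0 N, (4 / (2 * (j : ℝ) + 1) ^ 2) := by
        rw [Finset.mul_sum, Finset.range_eq_Ico]
    _ ≤ (N : ℝ) ^ 2 * 8 := by
        gcongr
        refine (tele 0 N (Nat.zero_le _)).trans ?_
        have : 0 ≤ 8 / ((N : ℝ) + 1) := by positivity
        norm_num
        exact this
    _ = _ := by ring

lemma sum_sig_cube (N : ℕ) : ∑ j ∈ Finset.range N, 1 / sig N j ^ 3 ≤ 16 * (N : ℝ) ^ 3 := by
  calc _ ≤ ∑ j ∈ Finset.range N, (N : ℝ) * 2 * (1 / sig N j ^ 2) := by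
        refine Finset.sum_le_sum fun j hj => ?_
        have hj := Finset.mem_range.mp hj
        obtain ⟨h1, -, -, -⟩ := sig_bounds N j hj
        have := inv_sig N j hj
        have h2 : 2 / (2 * (j : ℝ) + 1) ≤ 2 := div_le_self (by norm_num) (by
          have : (0 : ℝ) ≤ j := Nat.cast_nonneg j
          linarith)
        calc 1 / sig N j ^ 3 = 1 / sig N j * (1 / sig N j ^ 2) := by field_simp
          _ ≤ (N : ℝ) * 2 * (1 / sig N j ^ 2) := by
            gcongr
            refine this.trans ?_
            gcongr
    _ = (N : ℝ) * 2 * ∑ j ∈ Finset.range N, (1 / sig N j ^ 2) := by rw [Finset.mul_sum]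
    _ ≤ (N : ℝ) * 2 * (8 * N ^ 2) := by gcongr; exact sum_sig_sq N
    _ = _ := by ring

lemma odd_le_harm (J : ℕ) : ∑ j ∈ Finset.range J, 1 / (2 * (j : ℝ) + 1) ≤ 1 + Real.log J := by
  have := harmonic_le_one_add_log J
  refine le_trans ?_ this
  unfold harmonic
  push_cast
  refine Finset.sum_le_sum fun j _ => ?_
  rw [← one_div]
  have : (0 : ℝ) ≤ j := Nat.cast_nonneg j
  apply one_div_le_one_div_of_le <;> linarith

lemma sum_Y (N J m : ℕ) (hm : 0 < m) (hJ : J ≤ N) (Y : ℕ → ℝ)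
    (hY1 : ∀ j < N, Y j ≤ 1)
    (hY2 : ∀ j < N, Y j ≤ 1 / (m * sig N j)) :
    ∑ j ∈ Finset.range N, Y j / sig N j ≤ 2 * N * (1 + Real.log J) + N ^ 2 / m * (8 / ((J : ℝ) + 1)) := by
  have hmR : (0 : ℝ) < m := by exact_mod_cast hm
  rw [← Finset.sum_range_add_sum_Ico _ hJ]
  apply add_le_add
  · calc _ ≤ ∑ j ∈ Finset.range J, 2 * (N : ℝ) * (1 / (2 * (j : ℝ) + 1)) := by
          refine Finset.sum_le_sum fun j hj => ?_
          have hj : j < N := (Finset.mem_range.mp hj).trans_le hJ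
          obtain ⟨h1, -, -, -⟩ := sig_bounds N j hj
          calc Y j / sig N j ≤ 1 / sig N j := by gcongr; exact hY1 j hj
            _ ≤ _ := inv_sig N j hj
            _ = _ := by ring
      _ = 2 * N * ∑ j ∈ Finset.range J, (1 / (2 * (j : ℝ) + 1)) := by rw [Finset.mul_sum]
      _ ≤ _ := by gcongr; exact odd_le_harm J
  · calc _ ≤ ∑ j ∈ Finset.Ico J N, (N : ℝ) ^ 2 / m * (4 / (2 * (j : ℝ) + 1) ^ 2) := by
          refine Finset.sum_le_sum fun j hj => ?_
          have hj : j < N := (Finset.mem_Ico.mp hj).2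
          obtain ⟨h1, -, -, -⟩ := sig_bounds N j hj
          calc Y j / sig N j ≤ 1 / (m * sig N j) / sig N j := by gcongr; exact hY2 j hj
            _ = 1 / m * (1 / sig N j ^ 2) := by field_simp
            _ ≤ 1 / m * (N ^ 2 * (4 / (2 * (j : ℝ) + 1) ^ 2)) := by gcongr; exact inv_sig_sq N j hj
            _ = _ := by ring
      _ = (N : ℝ) ^ 2 / m * ∑ j ∈ Finset.Ico J N, (4 / (2 * (j : ℝ) + 1) ^ 2) := by
          rw [Finset.mul_sum]
      _ ≤ _ := by
          gcongr
          refine (tele J N hJ).trans ?_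
          have : 0 ≤ 8 / ((N : ℝ) + 1) := by positivity
          linarith

/-- odd harmonic sums -/
lemma odd_harm (N : ℕ) (hN : 0 < N) :
    |∑ j ∈ Finset.range N, 1 / (2 * (j : ℝ) + 1) - Real.log N / 2| ≤ 2 := by
  have key : ∀ n : ℕ, ∑ j ∈ Finset.range n, 1 / (2 * (j : ℝ) + 1) =
      ((harmonic (2 * n) : ℚ) : ℝ) - ((harmonic n : ℚ) : ℝ) / 2 := by
    intro n
    induction n with
    | zero => simp
    | succ n ih =>
      rw [Finset.sum_range_succ, ih, show 2 * (n + 1) = 2 * n + 1 + 1 by ring, harmonic_succ,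
        harmonic_succ, harmonic_succ]
      have hn : (0 : ℝ) ≤ n := Nat.cast_nonneg n
      push_cast
      field_simp
      ring
  have hNR : (0 : ℝ) < N := by exact_mod_cast hN
  have a1 := harmonic_le_one_add_log (2 * N)
  have a2 := log_add_one_le_harmonic (2 * N)
  have b1 := harmonic_le_one_add_log N
  have b2 := log_add_one_le_harmonic N
  push_cast at a1 a2 b1 b2
  have c1 : Real.log N ≤ Real.log (N + 1) := Real.log_le_log hNR (by linarith)
  have c2 : Real.log N ≤ Real.log (2 * N + 1) := Real.log_le_log hNR (by linarith)
  have c3 : Real.log (2 * N) = Real.log 2 + Real.log N := Real.log_mul two_ne_zero hNR.ne'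
  have c4 := Real.log_two_lt_d9
  rw [key, abs_le]
  constructor <;> linarith

lemma inv_S0 (q g : ℝ) (hq0 : 0 < q) (hq1 : q < Real.pi) (hg : 0 < g)
    (hc : Real.cosh g = 1 + 2 * Real.sin (q / 2) ^ 2) :
    |1 / Real.sinh g - 1 / q| ≤ 2 := by
  obtain ⟨x, rfl⟩ : ∃ x, q = 2 * x := ⟨q / 2, by ring⟩
  rw [mul_div_cancel_left₀ _ (two_ne_zero)] at hc
  have hx0 : 0 < x := by linarith
  have hx1 : x < Real.pi / 2 := by linarith
  have hx2 : x < 1.6 := by have := Real.pi_lt_d2; norm_num at *; linarith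
  have s1 := Real.mul_le_sin hx0.le hx1.le
  have s2 := Real.sin_lt hx0
  have s3 : x / 2 ≤ Real.sin x := by
    refine le_trans ?_ s1
    have : 1 / 2 ≤ 2 / Real.pi := by
      rw [div_le_div_iff₀ (by norm_num) Real.pi_pos]; linarith [Real.pi_le_four]
    nlinarith
  have s4 : x - x ^ 3 ≤ Real.sin x := by
    have := Real.sin_gt_sub_cube hx0
    have : 0 < x ^ 3 := by positivity
    linarith
  have s5 := Real.sin_le_one x
  set σ := Real.sin x with hσ
  have hσ0 : 0 < σ := by linarith
  obtain ⟨b1, b2, -, -⟩ := gamma0_bounds σ g hσ0 s5 hg hc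
  have hS : 0 < Real.sinh g := by linarith
  have t1 : 1 / Real.sinh g ≤ 1 / (2 * σ) := one_div_le_one_div_of_le (by positivity) b1
  have t2 : 1 / (2 * σ) - σ / 2 ≤ 1 / Real.sinh g := by
    refine le_trans ?_ (one_div_le_one_div_of_le hS b2)
    rw [show 1 / (2 * σ) - σ / 2 = (1 - σ ^ 2) / (2 * σ) by field_simp,
      div_le_div_iff₀ (by positivity) (by positivity)]
    have : 0 ≤ σ ^ 5 := by positivity
    nlinarith
  have t3 : 1 / (2 * x) ≤ 1 / (2 * σ) := one_div_le_one_div_of_le (by positivity) (by linarith)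
  have t4 : 1 / (2 * σ) - 1 / (2 * x) ≤ x := by
    rw [show 1 / (2 * σ) - 1 / (2 * x) = (x - σ) / (2 * (x * σ)) by field_simp,
      div_le_iff₀ (by positivity)]
    have : x ^ 2 * (x / 2) ≤ x ^ 2 * σ := by gcongr
    nlinarith
  rw [abs_le]; constructor <;> linarith

lemma sum_S0 (N : ℕ) (hN : 0 < N) (g : ℕ → ℝ) (hg : ∀ j < N, 0 < g j)
    (hc : ∀ j < N, Real.cosh (g j) = 1 + 2 * sig N j ^ 2) :
    |∑ j ∈ Finset.range N, 1 / Real.sinh (g j) - N / Real.pi * Real.log N| ≤ 4 * N := by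
  have hNR : (0 : ℝ) < N := by exact_mod_cast hN
  have hp := Real.pi_pos
  have h1 : |∑ j ∈ Finset.range N, (1 / Real.sinh (g j) - 1 / qq N j)| ≤ N * 2 := by
    refine (Finset.abs_sum_le_sum_abs _ _).trans ?_
    refine (Finset.sum_le_card_nsmul _ _ 2 ?_).trans (le_of_eq ?_)
    · intro j hj
      have hj := Finset.mem_range.mp hj
      obtain ⟨q0, q1⟩ := qq_bounds N j hj
      exact inv_S0 _ _ q0 q1 (hg j hj) (hc j hj)
    · simp
  have h2 : ∑ j ∈ Finset.range N, 1 / qq N j =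
      2 * N / Real.pi * ∑ j ∈ Finset.range N, 1 / (2 * (j : ℝ) + 1) := by
    rw [Finset.mul_sum]
    refine Finset.sum_congr rfl fun j _ => ?_
    unfold qq
    field_simp
  rw [Finset.sum_sub_distrib, h2] at h1
  have h3 := odd_harm N hN
  set A := ∑ j ∈ Finset.range N, 1 / (2 * (j : ℝ) + 1)
  set T := ∑ j ∈ Finset.range N, 1 / Real.sinh (g j)
  have h4 : |2 * N / Real.pi * (A - Real.log N / 2)| ≤ N * 2 := by
    rw [abs_mul, abs_of_pos (by positivity)]
    calc _ ≤ 2 * N / Real.pi * 2 := by gcongr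
      _ ≤ _ := by
        rw [div_mul_eq_mul_div, div_le_iff₀ hp]
        nlinarith [Real.pi_gt_three]
  rw [show T - N / Real.pi * Real.log N = (T - 2 * N / Real.pi * A) +
    2 * N / Real.pi * (A - Real.log N / 2) by ring]
  refine (abs_add_le _ _).trans ?_
  linarith

end CI

namespace CI

noncomputable def gam (w : ℝ) : ℝ := Real.arsinh (Real.sqrt (w ^ 2 - 1))

lemma gam_pos (w : ℝ) (h : 1 < w) : 0 < gam w := by
  unfold gam
  rw [Real.arsinh_pos_iff, Real.sqrt_pos]
  nlinarith

lemma cosh_gam (w : ℝ) (h : 1 < w) : Real.cosh (gam w) = w := by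
  unfold gam
  rw [Real.cosh_arsinh, Real.sq_sqrt (by nlinarith), show 1 + (w ^ 2 - 1) = w ^ 2 by ring,
    Real.sqrt_sq (by linarith)]

lemma Zpart_pos (M N : ℕ) (K : ℝ) : 0 < Zpart M N K := by
  unfold Zpart
  exact Finset.sum_pos (fun _ _ => Real.exp_pos _) Finset.univ_nonempty

/-- logarithm of the partition function -/
lemma log_Zpart (M N : ℕ) (hM : 0 < M) (K : ℝ) (hK : 0 < K) (g : ℕ → ℝ)
    (hg : ∀ j < N, Real.cosh (g j) = Real.sinh (2 * K) + 1 / Real.sinh (2 * K)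
      - Real.cos (qq N j)) (hg0 : ∀ j < N, 0 < g j)
    (hD : ∀ j < N, 0 ≤ 1 / Real.sinh (2 * K) - Real.cos (qq N j)) :
    Real.log (Zpart M N K) = 2 * M * N * (Real.log 2 + Real.log (Real.sinh (2 * K)))
      - 2 * N * Real.log (Real.cosh K) + ∑ j ∈ Finset.range N,
        Real.log (Gf (2 * M) (Real.cosh (2 * K)) (Real.sinh (2 * K)) (Real.cos (qq N j)) (g j)) := by
  have hs : 0 < Real.sinh (2 * K) := Real.sinh_pos_iff.mpr (by linarith)
  have hc := Real.cosh_pos K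
  have hG : ∀ j ∈ Finset.range N, Gf (2 * M) (Real.cosh (2 * K)) (Real.sinh (2 * K))
      (Real.cos (qq N j)) (g j) ≠ 0 := by
    intro j hj
    have hj := Finset.mem_range.mp hj
    exact (log_Gf (2 * M) _ _ _ _ (hg0 j hj)
      (mul_nonneg (Real.cosh_pos _).le (hD j hj))).2.ne'
  rw [Zpart_exact M N hM K hK g hg (fun j hj => (hg0 j hj).ne'),
    Real.log_mul (by positivity) (Finset.prod_ne_zero_iff.mpr hG), Real.log_prod hG,
    Real.log_div (by positivity) (by positivity), Real.log_pow, Real.log_pow,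
    Real.log_mul two_ne_zero hs.ne']
  push_cast
  ring

set_option maxHeartbeats 1000000 in
/-- quantitative bound at finite volume -/
lemma finite_bound (M N J : ℕ) (hM : 0 < M) (hN : 0 < N) (hJ : J ≤ N) (u : ℝ) (hu0 : 0 ≤ u)
    (hu : u ≤ 1 / 100) (huN : u * (2 * N) ≤ 1) :
    |u * (4 * Real.sqrt 2 * M * N - 4 / Real.pi * N * Real.log N) +
      (Real.log (Zpart M N (betac - u)) - Real.log (Zpart M N betac)) -
      16 / Real.pi * M * u ^ 2 * N * Real.log N| ≤
    10000000 * (M * N * u ^ 2 + u * N + (u * N) ^ 2 + (M * N * u ^ 2) * (u * N) ^ 2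
      + u * N * (1 + Real.log J) + u * N * (N / (M * ((J : ℝ) + 1)))
      + M * N * u ^ 2 * Real.log N * u + u ^ 2 * N * Real.log N) := by
  have hNR : (0 : ℝ) < N := by exact_mod_cast hN
  have hN1 : (1 : ℝ) ≤ N := by exact_mod_cast hN
  have hMR : (0 : ℝ) < M := by exact_mod_cast hM
  have hb := betac_gt
  set s := Real.sinh (2 * (betac - u)) with hs
  set C := Real.cosh (2 * (betac - u)) with hC
  obtain ⟨s0, s1, P1, e0, e1, P2, a0, a1, P3, C1, C0⟩ := params u hu0 hu s C hs hC
  have P4 := log_cosh_bound u hu0 hu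
  set w : ℕ → ℝ := fun j => s + 1 / s - Real.cos (qq N j) with hw
  set w0 : ℕ → ℝ := fun j => 2 - Real.cos (qq N j) with hw0
  have hsig := sig_bounds N
  have w01 : ∀ j < N, 1 < w0 j := by
    intro j hj
    obtain ⟨h1, h2, h3, h4⟩ := hsig j hj
    simp only [hw0, h4]; nlinarith
  have w1 : ∀ j < N, 1 < w j := by
    intro j hj
    have := w01 j hj
    simp only [hw, hw0] at *; linarith
  have Zu := log_Zpart M N hM (betac - u) (by linarith) (fun j => gam (w j))
    (fun j hj => cosh_gam _ (w1 j hj)) (fun j hj => gam_pos _ (w1 j hj))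
    (fun j hj => by rw [← hs]; have := Real.cos_le_one (qq N j); linarith)
  have Z0 := log_Zpart M N hM betac (by linarith) (fun j => gam (w0 j))
    (fun j hj => by rw [cosh_gam _ (w01 j hj), sinh_two_betac]; norm_num [hw0])
    (fun j hj => gam_pos _ (w01 j hj))
    (fun j hj => by rw [sinh_two_betac]; have := Real.cos_le_one (qq N j); linarith)
  rw [← hs, ← hC] at Zu
  rw [sinh_two_betac, cosh_two_betac, Real.log_one] at Z0
  -- modes
  set e := 1 / s - 1 with he
  set a := s + 1 / s - 2 with ha
  set Y : ℕ → ℝ := fun j => Real.exp (-(2 * ((2 * M : ℕ) : ℝ) * gam (w0 j))) with hY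
  have cg0 : ∀ j < N, Real.cosh (gam (w0 j)) = 1 + 2 * sig N j ^ 2 := by
    intro j hj
    obtain ⟨-, -, -, h4⟩ := hsig j hj
    rw [cosh_gam _ (w01 j hj)]; simp only [hw0, h4]; ring
  have modes : ∀ j ∈ Finset.range N,
      |Real.log (Gf (2 * M) C s (Real.cos (qq N j)) (gam (w j))) -
        Real.log (Gf (2 * M) (Real.sqrt 2) 1 (Real.cos (qq N j)) (gam (w0 j))) -
        ((2 * M : ℕ) * a + Real.sqrt 2 * e) * (1 / Real.sinh (gam (w0 j)))| ≤
      100000 * (u + u ^ 2 * (1 / sig N j ^ 2) + (2 * M : ℕ) * u ^ 4 * (1 / sig N j ^ 3)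
        + u * (Y j / sig N j)) := by
    intro j hj
    have hj := Finset.mem_range.mp hj
    obtain ⟨h1, h2, h3, h4⟩ := hsig j hj
    have huσ : u ≤ sig N j := by
      refine le_trans ?_ h3
      rw [le_div_iff₀ (by positivity)]
      have : (0 : ℝ) ≤ j := Nat.cast_nonneg j
      linarith
    have := mode (2 * M) (by omega) u (sig N j) C s (Real.cos (qq N j)) (gam (w j)) (gam (w0 j))
      hu0 h1 h2 huσ h4 e0 e1 a0 a1 C1 C0 (gam_pos _ (w1 j hj)) (gam_pos _ (w01 j hj))
      (cosh_gam _ (w1 j hj)) (cosh_gam _ (w01 j hj))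
    rw [mul_one_div]
    refine this.trans (le_of_eq ?_)
    simp only [hY]
    ring
  have smodes := (Finset.abs_sum_le_sum_abs _ _).trans (Finset.sum_le_sum modes)
  rw [Finset.sum_sub_distrib, Finset.sum_sub_distrib, ← Finset.mul_sum, ← Finset.mul_sum,
    Finset.sum_add_distrib, Finset.sum_add_distrib, Finset.sum_add_distrib, ← Finset.mul_sum,
    ← Finset.mul_sum, ← Finset.mul_sum, Finset.sum_const, Finset.card_range, nsmul_eq_mul] at smodes
  have hT := sum_S0 N hN (fun j => gam (w0 j)) (fun j hj => gam_pos _ (w01 j hj)) cg0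
  have hT0 : 0 ≤ ∑ j ∈ Finset.range N, 1 / Real.sinh (gam (w0 j)) := by
    refine Finset.sum_nonneg fun j hj => ?_
    have := Real.sinh_pos_iff.mpr (gam_pos _ (w01 j (Finset.mem_range.mp hj)))
    positivity
  have hYs := sum_Y N J (2 * M) (by omega) hJ Y
    (fun j hj => (y0_bound (2 * M) (by omega) (sig N j) _ (hsig j hj).1 (hsig j hj).2.1
      (gam_pos _ (w01 j hj)) (cg0 j hj)).1)
    (fun j hj => (y0_bound (2 * M) (by omega) (sig N j) _ (hsig j hj).1 (hsig j hj).2.1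
      (gam_pos _ (w01 j hj)) (cg0 j hj)).2)
  have h2s := sum_sig_sq N
  have h3s := sum_sig_cube N
  rw [Zu, Z0]
  set X1 := ∑ j ∈ Finset.range N, Real.log (Gf (2 * M) C s (Real.cos (qq N j)) (gam (w j)))
  set X0 := ∑ j ∈ Finset.range N,
    Real.log (Gf (2 * M) (Real.sqrt 2) 1 (Real.cos (qq N j)) (gam (w0 j)))
  set T := ∑ j ∈ Finset.range N, 1 / Real.sinh (gam (w0 j))
  set SY := ∑ j ∈ Finset.range N, Y j / sig N j
  set A2 := ∑ j ∈ Finset.range N, 1 / sig N j ^ 2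
  set A3 := ∑ j ∈ Finset.range N, 1 / sig N j ^ 3
  have hl0 : 0 ≤ Real.log N := Real.log_nonneg hN1
  have hlJ : 0 ≤ Real.log J := Real.log_natCast_nonneg J
  generalize hL : Real.log N = L at *
  generalize Real.log J = LJ at *
  have hp := Real.pi_gt_three
  clear_value X1 X0 T SY A2 A3
  clear Zu Z0 modes cg0 hsig
  push_cast at smodes hYs
  have hu1 : u ≤ 1 := by linarith
  -- bounds
  have B1 : |2 * M * N * (Real.log s + 2 * Real.sqrt 2 * u)| ≤ 200 * (M * N * u ^ 2) := by
    rw [abs_mul, abs_of_pos (by positivity)]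
    refine (mul_le_mul_of_nonneg_left P1 (by positivity)).trans (le_of_eq ?_)
    ring
  have B2 : |2 * N * (Real.log (Real.cosh betac) - Real.log (Real.cosh (betac - u)))| ≤
      2 * (u * N) := by
    rw [abs_mul, abs_of_pos (by positivity)]
    refine (mul_le_mul_of_nonneg_left P4 (by positivity)).trans (le_of_eq ?_)
    ring
  have B3 : |X1 - X0 - (2 * M * a + Real.sqrt 2 * e) * T| ≤
      100000 * (u * N + 8 * (u * N) ^ 2 + 32 * ((M * N * u ^ 2) * (u * N) ^ 2) +
        2 * (u * N * (1 + LJ)) + 4 * (u * N * (N / (M * ((J : ℝ) + 1))))) := by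
    refine smodes.trans ?_
    have i1 : u ^ 2 * A2 ≤ u ^ 2 * (8 * N ^ 2) := by gcongr
    have i2 : 2 * M * u ^ 4 * A3 ≤ 2 * M * u ^ 4 * (16 * N ^ 3) := by gcongr
    have i3 : u * SY ≤ u * (2 * N * (1 + LJ) + N ^ 2 / (2 * M) * (8 / ((J : ℝ) + 1))) := by gcongr
    have i4 : u * (2 * N * (1 + LJ) + N ^ 2 / (2 * M) * (8 / ((J : ℝ) + 1))) =
      2 * (u * N * (1 + LJ)) + 4 * (u * N * (N / (M * ((J : ℝ) + 1)))) := by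
      have : (0 : ℝ) ≤ J := Nat.cast_nonneg J
      field_simp; ring
    nlinarith
  have hTu : T ≤ 4 * N + N * L := by
    rw [abs_le] at hT
    have : N / Real.pi * L ≤ N * L := by
      gcongr
      exact div_le_self hNR.le (by linarith)
    linarith
  have B4 : |2 * M * (a - 8 * u ^ 2) * T| ≤ 2000 * (M * N * u ^ 2 * L * u) + 8000 * (M * N * u ^ 2) := by
    rw [abs_mul, abs_mul, abs_of_pos (by positivity : (0 : ℝ) < 2 * M), abs_of_nonneg hT0]
    have : 2 * M * |a - 8 * u ^ 2| * T ≤ 2 * M * (1000 * u ^ 3) * (4 * N + N * L) := by gcongr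
    refine this.trans ?_
    have : M * N * u ^ 2 * u ≤ M * N * u ^ 2 := mul_le_of_le_one_right (by positivity) hu1
    nlinarith
  have B5 : |16 * M * u ^ 2 * (T - N / Real.pi * L)| ≤ 64 * (M * N * u ^ 2) := by
    rw [abs_mul, abs_of_nonneg (by positivity)]
    refine (mul_le_mul_of_nonneg_left hT (by positivity)).trans (le_of_eq ?_)
    ring
  have B6 : |(Real.sqrt 2 * e - 4 * u) * T| ≤ 400 * (u * N) + 100 * (u ^ 2 * N * L) := by
    rw [abs_mul, abs_of_nonneg hT0]
    have : |Real.sqrt 2 * e - 4 * u| * T ≤ 100 * u ^ 2 * (4 * N + N * L) := by gcongr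
    refine this.trans ?_
    have : u * N * u ≤ u * N := mul_le_of_le_one_right (by positivity) hu1
    nlinarith
  have B7 : |4 * u * (T - N / Real.pi * L)| ≤ 16 * (u * N) := by
    rw [abs_mul, abs_of_nonneg (by positivity)]
    refine (mul_le_mul_of_nonneg_left hT (by positivity)).trans (le_of_eq ?_)
    ring
  have split : u * (4 * Real.sqrt 2 * M * N - 4 / Real.pi * N * L) +
      (2 * M * N * (Real.log 2 + Real.log s) - 2 * N * Real.log (Real.cosh (betac - u)) + X1 -
        (2 * M * N * (Real.log 2 + 0) - 2 * N * Real.log (Real.cosh betac) + X0)) -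
      16 / Real.pi * M * u ^ 2 * N * L =
      2 * M * N * (Real.log s + 2 * Real.sqrt 2 * u) +
      2 * N * (Real.log (Real.cosh betac) - Real.log (Real.cosh (betac - u))) +
      (X1 - X0 - (2 * M * a + Real.sqrt 2 * e) * T) + 2 * M * (a - 8 * u ^ 2) * T +
      16 * M * u ^ 2 * (T - N / Real.pi * L) + (Real.sqrt 2 * e - 4 * u) * T +
      4 * u * (T - N / Real.pi * L) := by ring
  rw [split]
  have n1 : 0 ≤ M * N * u ^ 2 := by positivity
  have n2 : 0 ≤ u * N := by positivity
  have n3 : 0 ≤ (u * N) ^ 2 := by positivity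
  have n4 : 0 ≤ (M * N * u ^ 2) * (u * N) ^ 2 := by positivity
  have n5 : 0 ≤ u * N * (1 + LJ) := by positivity
  have n6 : 0 ≤ u * N * (N / (M * ((J : ℝ) + 1))) := by positivity
  have n7 : 0 ≤ M * N * u ^ 2 * L * u := by positivity
  have n8 : 0 ≤ u ^ 2 * N * L := by positivity
  rw [abs_le] at *
  constructor <;> linarith

end CI

namespace CI

lemma expect_eq (M N : ℕ) (t u : ℝ) (hu : u = t / Real.sqrt (4 * M * N * Real.log N)) :
    (∑ σ : Fin (2 * M) × Fin (2 * N) → Bool,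
      Real.exp (t * Ehat M N σ) * Real.exp (-betac * energy M N σ)) / Zpart M N betac =
    Real.exp (u * (4 * Real.sqrt 2 * M * N - 4 / Real.pi * N * Real.log N) +
      (Real.log (Zpart M N (betac - u)) - Real.log (Zpart M N betac))) := by
  rw [Real.exp_add, Real.exp_sub, Real.exp_log (Zpart_pos _ _ _), Real.exp_log (Zpart_pos _ _ _),
    mul_div_assoc']
  congr 1
  rw [Zpart, Finset.mul_sum]
  refine Finset.sum_congr rfl fun σ _ => ?_
  rw [← Real.exp_add, ← Real.exp_add]
  congr 1
  rw [hu, Ehat]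
  ring

lemma main_limit (M : ℕ → ℕ) (hMpos : ∀ N, 0 < M N)
    (hM : Filter.Tendsto (fun N : ℕ =>
        (N : ℝ) * (Real.log (Real.log N)) ^ 2 / ((M N : ℝ) * Real.log N)) Filter.atTop (nhds 0))
    (t : ℝ) (ht : 0 ≤ t) :
    Filter.Tendsto (fun N : ℕ =>
      (t / Real.sqrt (4 * M N * N * Real.log N)) *
        (4 * Real.sqrt 2 * M N * N - 4 / Real.pi * N * Real.log N) +
      (Real.log (Zpart (M N) N (betac - t / Real.sqrt (4 * M N * N * Real.log N))) -
        Real.log (Zpart (M N) N betac))) Filter.atTop (nhds (4 * t ^ 2 / Real.pi)) := by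
  set h : ℕ → ℝ := fun N => (N : ℝ) * (Real.log (Real.log N)) ^ 2 / ((M N : ℝ) * Real.log N) with hh
  have hl : Filter.Tendsto (fun N : ℕ => Real.log N) Filter.atTop Filter.atTop :=
    Real.tendsto_log_atTop.comp tendsto_natCast_atTop_atTop
  have hll : Filter.Tendsto (fun N : ℕ => Real.log (Real.log N)) Filter.atTop Filter.atTop :=
    Real.tendsto_log_atTop.comp hl
  set u : ℕ → ℝ := fun N => t / Real.sqrt (4 * M N * N * Real.log N) with hu
  set p : ℕ → ℝ := fun N => u N * N * Real.log (Real.log N) with hp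
  have ev1 : ∀ᶠ N : ℕ in Filter.atTop, 1 ≤ N ∧ 1 ≤ Real.log N ∧ 1 ≤ Real.log (Real.log N) :=
    (Filter.eventually_ge_atTop 1).and
      ((hl.eventually_ge_atTop 1).and (hll.eventually_ge_atTop 1))
  have u2 : ∀ N : ℕ, 1 ≤ N → 1 ≤ Real.log N → u N ^ 2 = t ^ 2 / (4 * M N * N * Real.log N) := by
    intro N h1 h2
    have := hMpos N
    simp only [hu]
    rw [div_pow, Real.sq_sqrt (by positivity)]
  have u0 : ∀ N, 0 ≤ u N := fun N => by simp only [hu]; positivity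
  have hp0 : Filter.Tendsto p Filter.atTop (nhds 0) := by
    have h1 : Filter.Tendsto (fun N => Real.sqrt (t ^ 2 / 4 * h N)) Filter.atTop (nhds 0) := by
      have := (hM.const_mul (t ^ 2 / 4)).sqrt
      simpa using this
    refine h1.congr' ?_
    filter_upwards [ev1] with N hN
    obtain ⟨n1, n2, n3⟩ := hN
    have hNR : (1 : ℝ) ≤ N := by exact_mod_cast n1
    have hMR : (0 : ℝ) < M N := by exact_mod_cast hMpos N
    have hpn : 0 ≤ p N := by
      have := u0 N
      simp only [hp]; positivity
    rw [Real.sqrt_eq_iff_eq_sq _ hpn]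
    · simp only [hp, hh]
      rw [mul_pow, mul_pow, u2 N n1 n2]
      field_simp
    · simp only [hh]; positivity
  have hinv : Filter.Tendsto (fun N : ℕ => (Real.log N)⁻¹) Filter.atTop (nhds 0) :=
    tendsto_inv_atTop_zero.comp hl
  set Bd : ℕ → ℝ := fun N => 10000000 * (t ^ 2 / 4 * (Real.log N)⁻¹ + p N + p N ^ 2 +
    t ^ 2 / 4 * (Real.log N)⁻¹ * p N ^ 2 + 2 * p N + p N * h N + t ^ 2 / 4 * p N + p N ^ 2) with hBd
  have hBd0 : Filter.Tendsto Bd Filter.atTop (nhds 0) := by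
    have a1 := hinv.const_mul (t ^ 2 / 4)
    have := ((((((((a1.add hp0).add (hp0.pow 2)).add (a1.mul (hp0.pow 2))).add
      (hp0.const_mul 2)).add (hp0.mul hM)).add (hp0.const_mul (t ^ 2 / 4))).add (hp0.pow 2))).const_mul
      (10000000 : ℝ)
    simpa using this
  rw [tendsto_iff_norm_sub_tendsto_zero]
  refine squeeze_zero' (Filter.Eventually.of_forall fun _ => norm_nonneg _) ?_ hBd0
  have ev2 : ∀ᶠ N : ℕ in Filter.atTop, p N < 1 / 200 := hp0.eventually_lt_const (by norm_num)
  filter_upwards [ev1, ev2] with N hN hpN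
  obtain ⟨n1, n2, n3⟩ := hN
  have hNR : (1 : ℝ) ≤ N := by exact_mod_cast n1
  have hMR : (0 : ℝ) < M N := by exact_mod_cast hMpos N
  have hU := u2 N n1 n2
  have hU0 := u0 N
  have l0 : 0 < Real.log N := by linarith
  have lN : Real.log N ≤ N := (Real.log_le_sub_one_of_pos (by linarith)).trans (by linarith)
  have uNp : u N * N ≤ p N := by
    simp only [hp]
    exact le_mul_of_one_le_right (by positivity) n3
  have uuN : u N ≤ u N * N := le_mul_of_one_le_right hU0 hNR
  have hJN : ⌊Real.log N⌋₊ ≤ N := by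
    have := Nat.floor_le l0.le
    exact_mod_cast this.trans lN
  have fb := finite_bound (M N) N ⌊Real.log N⌋₊ (hMpos N) n1 hJN (u N) hU0 (by linarith)
    (by linarith)
  have MNu : M N * N * u N ^ 2 = t ^ 2 / 4 * (Real.log N)⁻¹ := by
    rw [hU]; field_simp
  have MNul : M N * N * u N ^ 2 * Real.log N = t ^ 2 / 4 := by
    rw [MNu]; field_simp
  have E1 : 16 / Real.pi * M N * u N ^ 2 * N * Real.log N = 4 * t ^ 2 / Real.pi := by
    rw [show 16 / Real.pi * M N * u N ^ 2 * N * Real.log N =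
      16 / Real.pi * (M N * N * u N ^ 2 * Real.log N) by ring, MNul]
    ring
  rw [E1] at fb
  rw [Real.norm_eq_abs]
  refine fb.trans ?_
  simp only [hBd]
  have un0 : 0 ≤ u N * N := by positivity
  have p0 : 0 ≤ p N := un0.trans uNp
  have J1 : 1 ≤ ⌊Real.log N⌋₊ := Nat.le_floor (by exact_mod_cast n2)
  have J1R : (1 : ℝ) ≤ (⌊Real.log N⌋₊ : ℝ) := by exact_mod_cast J1
  have k0 : (u N * N) ^ 2 ≤ p N ^ 2 := by gcongr
  have k1 : u N * N * (1 + Real.log (⌊Real.log N⌋₊ : ℝ)) ≤ 2 * p N := by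
    have : Real.log (⌊Real.log N⌋₊ : ℝ) ≤ Real.log (Real.log N) :=
      Real.log_le_log (by linarith) (Nat.floor_le l0.le)
    calc _ ≤ u N * N * (2 * Real.log (Real.log N)) := by gcongr; linarith
      _ = _ := by simp only [hp]; ring
  have k2 : u N * N * (N / (M N * ((⌊Real.log N⌋₊ : ℝ) + 1))) ≤ p N * h N := by
    have : Real.log N ≤ (⌊Real.log N⌋₊ : ℝ) + 1 := (Nat.lt_floor_add_one _).le
    refine mul_le_mul uNp ?_ (by positivity) p0
    simp only [hh]
    have : (1 : ℝ) ≤ Real.log (Real.log N) ^ 2 := one_le_pow₀ n3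
    calc (N : ℝ) / (M N * ((⌊Real.log N⌋₊ : ℝ) + 1)) ≤ N / (M N * Real.log N) := by gcongr
      _ ≤ _ := by
        gcongr
        exact le_mul_of_one_le_right (by positivity) this
  have k3 : t ^ 2 / 4 * u N ≤ t ^ 2 / 4 * p N := by
    have : u N ≤ p N := uuN.trans uNp
    gcongr
  have k4 : u N ^ 2 * N * Real.log N ≤ p N ^ 2 := by
    refine le_trans ?_ k0
    calc u N ^ 2 * N * Real.log N ≤ u N ^ 2 * N * N := by gcongr
      _ = _ := by ring
  have k5 : t ^ 2 / 4 * (Real.log N)⁻¹ * (u N * N) ^ 2 ≤ t ^ 2 / 4 * (Real.log N)⁻¹ * p N ^ 2 := by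
    gcongr
  rw [MNul, MNu]
  linarith

end CI

/-- Central limit theorem for the total energy of the critical Ising model on a
`2M × 2N` cylinder: if `M = M(N)` satisfies `N(ln ln N)²/(M(N)·ln N) → 0`, then for every
fixed `t ≥ 0` the Gibbs expectation `⟨e^{t·Ê_{M,N}}⟩` at `β_c = ln(1+√2)/2` converges to
`e^{4t²/π}` as `N → ∞`. -/
theorem stmt19 (M : ℕ → ℕ) (hMpos : ∀ N, 0 < M N)
    (hM : Tendsto (fun N : ℕ =>
        (N : ℝ) * (Real.log (Real.log N)) ^ 2 / ((M N : ℝ) * Real.log N)) atTop (nhds 0))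
    (t : ℝ) (ht : 0 ≤ t) :
    Tendsto (fun N : ℕ =>
        (∑ σ : Fin (2 * M N) × Fin (2 * N) → Bool,
            Real.exp (t * Ehat (M N) N σ) * Real.exp (-betac * energy (M N) N σ)) /
          Zpart (M N) N betac)
      atTop (nhds (Real.exp (4 * t ^ 2 / Real.pi))) := by
  simp only [CI.expect_eq _ _ t _ rfl]
  exact (Real.continuous_exp.tendsto _).comp (CI.main_limit M hMpos hM t ht)
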